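/- arXiv:0901.1963 — 6 statements merged into one kernel-verified Lean document; each statement's English description precedes it below -/
import Mathlib

section
/- Suppose in addition that a < 0. For every ε > 0 there exists a constant C > 0 (depending on ε, a and f) such that for every real B ≥ 2, the number of pairs ((y,z,t),(u,v)) with (y,z,t) ∈ ℤ³ primitive, (u,v) ∈ ℤ² primitive, max(|v²t|, |uvt|, |u²t|, |y|, |z|) ≤ B and y² − a·z² = t²·F(u,v), is at most C·B^{1+ε}. In particular the growth rate of this counting function is at most 1. -/
/-- The binary quartic form `F(u,v) = v⁴·f(u/v)`, the degree-4 homogenization of `f`. -/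
noncomputable def binQuartic (f : Polynomial ℤ) (u v : ℤ) : ℤ :=
  ∑ i ∈ Finset.range 5, f.coeff i * u ^ i * v ^ (4 - i)

/-- The divisor bound: the number of divisors of `n` is `O(n ^ δ)` for every `δ > 0`. -/
theorem exists_card_divisors_le_rpow (δ : ℝ) (hδ : 0 < δ) :
    ∃ C : ℝ, 1 ≤ C ∧ ∀ n : ℕ, n ≠ 0 → (n.divisors.card : ℝ) ≤ C * (n : ℝ) ^ δ := by
  have hlog : 0 < Real.log 2 := Real.log_pos (by norm_num)
  set M : ℝ := 1 + 1 / (δ * Real.log 2) with hM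
  have hM1 : 1 ≤ M := by
    have : 0 < 1 / (δ * Real.log 2) := by positivity
    linarith
  set P : ℕ := ⌈(2 : ℝ) ^ (1 / δ)⌉₊ with hP
  refine ⟨M ^ P, one_le_pow₀ hM1, fun n hn => ?_⟩
  have key : ∀ p ∈ n.primeFactors, ((n.factorization p + 1 : ℕ) : ℝ) ≤
      (if p < P then M else 1) * ((p : ℝ) ^ n.factorization p) ^ δ := by
    intro p hp
    have hp2 : (2 : ℝ) ≤ p := by exact_mod_cast (Nat.prime_of_mem_primeFactors hp).two_le
    set k := n.factorization p
    have hcomm : ((p : ℝ) ^ k) ^ δ = ((p : ℝ) ^ δ) ^ k := by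
      rw [← Real.rpow_natCast, ← Real.rpow_natCast, ← Real.rpow_mul (by positivity),
        ← Real.rpow_mul (by positivity), mul_comm]
    rw [hcomm]
    split_ifs with h
    · have h1 : 1 + δ * Real.log 2 ≤ (p : ℝ) ^ δ := by
        have h2 : (2 : ℝ) ^ δ ≤ (p : ℝ) ^ δ := Real.rpow_le_rpow (by norm_num) hp2 hδ.le
        have h3 := Real.add_one_le_exp (δ * Real.log 2)
        rw [mul_comm δ, ← Real.rpow_def_of_pos (by norm_num)] at h3
        linarith
      have h4 : 1 + (k : ℝ) * (δ * Real.log 2) ≤ ((p : ℝ) ^ δ) ^ k :=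
        (one_add_mul_le_pow (by nlinarith [mul_pos hδ hlog]) k).trans
          (pow_le_pow_left₀ (by positivity) h1 k)
      have h5 : ((k + 1 : ℕ) : ℝ) ≤ M * (1 + (k : ℝ) * (δ * Real.log 2)) := by
        have hx : M * (1 + (k : ℝ) * (δ * Real.log 2)) =
            1 + k + (k : ℝ) * (δ * Real.log 2) + 1 / (δ * Real.log 2) := by
          rw [hM]; field_simp; ring
        rw [hx]
        have : 0 < 1 / (δ * Real.log 2) := by positivity
        have : 0 ≤ (k : ℝ) * (δ * Real.log 2) := by positivity
        push_cast
        linarith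
      exact h5.trans (mul_le_mul_of_nonneg_left h4 (by linarith))
    · rw [one_mul]
      have h1 : (2 : ℝ) ≤ (p : ℝ) ^ δ := by
        have h2 : (2 : ℝ) ^ (1 / δ) ≤ p :=
          (Nat.le_ceil _).trans (by exact_mod_cast not_lt.mp h)
        have h3 := Real.rpow_le_rpow (by positivity) h2 hδ.le
        rwa [← Real.rpow_mul (by norm_num), one_div_mul_cancel hδ.ne', Real.rpow_one] at h3
      have h4 : ((k + 1 : ℕ) : ℝ) ≤ (2 : ℝ) ^ k := by exact_mod_cast Nat.lt_two_pow_self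
      exact h4.trans (pow_le_pow_left₀ (by norm_num) h1 k)
  have hprod : (n : ℝ) ^ δ = ∏ p ∈ n.primeFactors, ((p : ℝ) ^ n.factorization p) ^ δ := by
    rw [Real.finsetProd_rpow _ _ (fun i _ => by positivity)]
    congr 1
    conv_lhs => rw [← Nat.prod_factorization_pow_eq_self hn]
    rw [Finsupp.prod, Nat.support_factorization]
    push_cast
    rfl
  rw [Nat.card_divisors hn, Nat.cast_prod, hprod]
  refine (Finset.prod_le_prod (fun _ _ => by positivity) key).trans ?_
  rw [Finset.prod_mul_distrib]
  refine mul_le_mul_of_nonneg_right ?_ (Finset.prod_nonneg fun _ _ => by positivity)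
  rw [← Finset.prod_filter, Finset.prod_const]
  refine pow_le_pow_right₀ hM1 ?_
  calc _ ≤ (Finset.range P).card := Finset.card_le_card fun x hx => by
        simpa using (Finset.mem_filter.mp hx).2
    _ = P := Finset.card_range P

/-- Two solutions of `y² + d z² ≡ 0` modulo `e` lying over the same ratio `± y₀ / z₀` have norm
product divisible by `e` in both coordinates. -/
theorem dvd_cross_of_same_ratio {d e y₀ z₀ y₁ z₁ y₂ z₂ s : ℤ} (hs : s ^ 2 = 1)
    (hcop : IsCoprime e z₀) (h₀ : e ∣ y₀ ^ 2 + d * z₀ ^ 2)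
    (h₁ : e ∣ y₁ * z₀ - s * (y₀ * z₁)) (h₂ : e ∣ y₂ * z₀ - s * (y₀ * z₂)) :
    e ∣ y₁ * z₂ - y₂ * z₁ ∧ e ∣ y₁ * y₂ + d * (z₁ * z₂) := by
  constructor
  · refine hcop.dvd_of_dvd_mul_left ?_
    have : z₀ * (y₁ * z₂ - y₂ * z₁) =
        z₂ * (y₁ * z₀ - s * (y₀ * z₁)) - z₁ * (y₂ * z₀ - s * (y₀ * z₂)) := by ring
    rw [this]
    exact dvd_sub (h₁.mul_left _) (h₂.mul_left _)
  · refine (hcop.pow_right (n := 2)).dvd_of_dvd_mul_left ?_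
    have : z₀ ^ 2 * (y₁ * y₂ + d * (z₁ * z₂)) =
        (y₂ * z₀) * (y₁ * z₀ - s * (y₀ * z₁)) + (s * (y₀ * z₁)) * (y₂ * z₀ - s * (y₀ * z₂)) +
          z₁ * z₂ * (y₀ ^ 2 + d * z₀ ^ 2) := by
      linear_combination y₀ ^ 2 * z₁ * z₂ * hs
    rw [this]
    exact dvd_add (dvd_add (h₁.mul_left _) (h₂.mul_left _)) (h₀.mul_left _)

theorem isCoprime_right_of_primitive_rep {d y z n : ℤ} (h : y ^ 2 + d * z ^ 2 = n)
    (hg : Int.gcd y z = 1) : IsCoprime n z := by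
  have h1 : IsCoprime (y ^ 2) z := (Int.isCoprime_iff_gcd_eq_one.mpr hg).pow_left
  rw [← h, show d * z ^ 2 = z * (d * z) by ring]
  exact h1.add_mul_left_left _

theorem div_gcd_dvd_of_dvd_mul {n : ℕ} (hn : n ≠ 0) {x w : ℤ} (h : (n : ℤ) ∣ x * w) :
    ((n / Int.gcd x n : ℕ) : ℤ) ∣ w := by
  rw [Int.natCast_dvd] at h ⊢
  rw [Int.natAbs_mul] at h
  have hg : Int.gcd x n = Nat.gcd n x.natAbs := by
    rw [Int.gcd_comm, Int.gcd]; simp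
  rw [hg]
  have h1 : n ∣ Nat.gcd n x.natAbs * w.natAbs := Nat.dvd_gcd_mul_iff_dvd_mul.mpr h
  have hpos : 0 < Nat.gcd n x.natAbs := Nat.gcd_pos_of_pos_left _ (Nat.pos_of_ne_zero hn)
  refine Nat.dvd_of_mul_dvd_mul_left hpos ?_
  rwa [Nat.mul_div_cancel' (Nat.gcd_dvd_left _ _)]

/-- The number of primitive representations of `n` by `y² + d z²` is at most a constant times the
number of divisors of `n`. -/
theorem card_primitive_reps_le {d n : ℕ} (hd : d ≠ 0) (hn : n ≠ 0) (s : Finset (ℤ × ℤ))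
    (hs : ∀ p ∈ s, p.1 ^ 2 + d * p.2 ^ 2 = (n : ℤ) ∧ Int.gcd p.1 p.2 = 1) :
    s.card ≤ (8 * d + 1) ^ 2 * n.divisors.card := by
  rcases s.eq_empty_or_nonempty with rfl | ⟨p₀, hp₀⟩
  · simp
  obtain ⟨h₀, hg₀⟩ := hs p₀ hp₀
  have hc₀ := isCoprime_right_of_primitive_rep h₀ hg₀
  refine Finset.card_le_mul_card_image_of_maps_to
    (f := fun p : ℤ × ℤ => Int.gcd (p.1 * p₀.2 - p₀.1 * p.2) n) ?_ _ ?_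
  · intro p _
    rw [Nat.mem_divisors]
    exact ⟨by exact_mod_cast Int.gcd_dvd_right (p.1 * p₀.2 - p₀.1 * p.2) (n : ℤ), hn⟩
  intro g hg
  have hgn : g ∣ n := Nat.dvd_of_mem_divisors hg
  rcases (s.filter fun p => Int.gcd (p.1 * p₀.2 - p₀.1 * p.2) n = g).eq_empty_or_nonempty with
    he | ⟨p₁, hp₁⟩
  · simp [he]
  have hcong : ∀ p ∈ s.filter fun p => Int.gcd (p.1 * p₀.2 - p₀.1 * p.2) n = g,
      (g : ℤ) ∣ p.1 * p₀.2 - 1 * (p₀.1 * p.2) ∧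
        ((n / g : ℕ) : ℤ) ∣ p.1 * p₀.2 - (-1) * (p₀.1 * p.2) := by
    intro p hp
    obtain ⟨hps, hpg⟩ := Finset.mem_filter.mp hp
    obtain ⟨h, -⟩ := hs p hps
    constructor
    · rw [← hpg, one_mul]; exact Int.gcd_dvd_left _ _
    · rw [← hpg]
      refine div_gcd_dvd_of_dvd_mul hn ⟨p₀.2 ^ 2 - p.2 ^ 2, ?_⟩
      linear_combination p₀.2 ^ 2 * h - p.2 ^ 2 * h₀
  set h := Nat.gcd g (n / g) with hh
  set m := Nat.lcm g (n / g) with hm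
  have hmh : m * h = n := by
    rw [mul_comm, hm, hh, Nat.gcd_mul_lcm, Nat.mul_div_cancel' hgn]
  have hmpos : m ≠ 0 := by rintro h0; simp [h0] at hmh; exact hn hmh.symm
  have hgnZ : (g : ℤ) ∣ n := by exact_mod_cast hgn
  have hgnZ' : ((n / g : ℕ) : ℤ) ∣ n := by exact_mod_cast Nat.div_dvd_of_dvd hgn
  have hnZ : (n : ℤ) ≠ 0 := by exact_mod_cast hn
  obtain ⟨hp₁s, -⟩ := Finset.mem_filter.mp hp₁
  obtain ⟨h₁, hg₁⟩ := hs p₁ hp₁s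
  have hc₁ := isCoprime_right_of_primitive_rep h₁ hg₁
  have hh4 : h ≤ 4 * d := by
    obtain ⟨ha, hb⟩ := hcong p₁ hp₁
    have hhg : (h : ℤ) ∣ g := by exact_mod_cast Nat.gcd_dvd_left _ _
    have hhg' : (h : ℤ) ∣ (n / g : ℕ) := by exact_mod_cast Nat.gcd_dvd_right _ _
    have hhn : (h : ℤ) ∣ n := hhg.trans hgnZ
    have e1 : (h : ℤ) ∣ p₀.2 * (2 * p₁.1) := by
      have := dvd_add (hhg.trans ha) (hhg'.trans hb)
      rwa [show p₁.1 * p₀.2 - 1 * (p₀.1 * p₁.2) + (p₁.1 * p₀.2 - (-1) * (p₀.1 * p₁.2)) =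
        p₀.2 * (2 * p₁.1) by ring] at this
    have e2 : (h : ℤ) ∣ 2 * p₁.1 := (hc₀.of_isCoprime_of_dvd_left hhn).dvd_of_dvd_mul_left e1
    have e3 : (h : ℤ) ∣ p₁.2 ^ 2 * (4 * d) := by
      have : p₁.2 ^ 2 * (4 * (d : ℤ)) = 4 * n - (2 * p₁.1) * (2 * p₁.1) := by
        linear_combination 4 * h₁
      rw [this]
      exact dvd_sub (hhn.mul_left _) (e2.mul_left _)
    have e4 : (h : ℤ) ∣ 4 * d :=
      ((hc₁.of_isCoprime_of_dvd_left hhn).pow_right (n := 2)).dvd_of_dvd_mul_left e3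
    exact Nat.le_of_dvd (by omega) (by exact_mod_cast e4)
  have hdiv : ∀ p ∈ s.filter fun p => Int.gcd (p.1 * p₀.2 - p₀.1 * p.2) n = g,
      (m : ℤ) ∣ p₁.1 * p.2 - p.1 * p₁.2 ∧ (m : ℤ) ∣ p₁.1 * p.1 + d * (p₁.2 * p.2) := by
    intro p hp
    obtain ⟨ha, hb⟩ := hcong p₁ hp₁
    obtain ⟨ha', hb'⟩ := hcong p hp
    have hA := dvd_cross_of_same_ratio (d := d) (by norm_num)
      (hc₀.of_isCoprime_of_dvd_left hgnZ) (h₀ ▸ hgnZ) ha ha'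
    have hB := dvd_cross_of_same_ratio (d := d) (by norm_num)
      (hc₀.of_isCoprime_of_dvd_left hgnZ') (h₀ ▸ hgnZ') hb hb'
    simp only [Int.natCast_dvd] at hA hB ⊢
    exact ⟨Nat.lcm_dvd hA.1 hB.1, Nat.lcm_dvd hA.2 hB.2⟩
  have hbox : ((Finset.Icc (-(4 * d : ℤ)) (4 * d)) ×ˢ (Finset.Icc (-(4 * d : ℤ)) (4 * d))).card =
      (8 * d + 1) ^ 2 := by
    rw [Finset.card_product, Int.card_Icc, sq]
    congr 1 <;> omega
  rw [← hbox]
  have hmZ : (m : ℤ) ≠ 0 := by exact_mod_cast hmpos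
  have hmhZ : (m : ℤ) * h = n := by exact_mod_cast hmh
  refine Finset.card_le_card_of_injOn (fun p => ((p₁.1 * p.1 + d * (p₁.2 * p.2)) / m,
    (p₁.1 * p.2 - p.1 * p₁.2) / m)) ?_ ?_
  · intro p hp
    obtain ⟨⟨B, hB⟩, ⟨A, hA⟩⟩ := hdiv p hp
    obtain ⟨hp', -⟩ := hs p (Finset.mem_filter.mp hp).1
    have hAB : A ^ 2 + d * B ^ 2 = (h : ℤ) ^ 2 := by
      refine mul_left_cancel₀ (pow_ne_zero 2 hmZ) ?_
      have : (p₁.1 * p.1 + d * (p₁.2 * p.2)) ^ 2 + d * (p₁.1 * p.2 - p.1 * p₁.2) ^ 2 =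
          (n : ℤ) ^ 2 := by
        linear_combination (p.1 ^ 2 + d * p.2 ^ 2) * h₁ + n * hp'
      rw [hA, hB, ← hmhZ] at this
      linear_combination this
    have hd1 : (1 : ℤ) ≤ d := by exact_mod_cast Nat.pos_of_ne_zero hd
    have hA2 : |A| ≤ h := abs_le_of_sq_le_sq (by nlinarith [sq_nonneg B]) (by positivity)
    have hB2 : |B| ≤ h := abs_le_of_sq_le_sq (by nlinarith [sq_nonneg A, sq_nonneg B])
      (by positivity)
    rw [abs_le] at hA2 hB2
    have hh4' : (h : ℤ) ≤ 4 * d := by exact_mod_cast hh4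
    simp only [hA, hB, Int.mul_ediv_cancel_left _ hmZ, Finset.coe_product, Set.mem_prod,
      Finset.coe_Icc, Set.mem_Icc]
    omega
  · intro p hp q hq hpq
    obtain ⟨⟨B, hB⟩, ⟨A, hA⟩⟩ := hdiv p hp
    obtain ⟨⟨B', hB'⟩, ⟨A', hA'⟩⟩ := hdiv q hq
    simp only [hA, hB, hA', hB', Int.mul_ediv_cancel_left _ hmZ, Prod.mk.injEq] at hpq
    obtain ⟨rfl, rfl⟩ := hpq
    refine Prod.ext (mul_left_cancel₀ hnZ ?_) (mul_left_cancel₀ hnZ ?_)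
    · linear_combination (q.1 - p.1) * h₁ + p₁.1 * (hA - hA') - d * p₁.2 * (hB - hB')
    · linear_combination (q.2 - p.2) * h₁ + p₁.2 * (hA - hA') + p₁.1 * (hB - hB')

/-- The number of representations of `n` by `y² + d z²` is at most a constant times the
square of the number of divisors of `n`. -/
theorem card_reps_le {d n : ℕ} (hd : d ≠ 0) (hn : n ≠ 0) (s : Finset (ℤ × ℤ))
    (hs : ∀ p ∈ s, p.1 ^ 2 + d * p.2 ^ 2 = (n : ℤ)) :
    s.card ≤ (8 * d + 1) ^ 2 * n.divisors.card ^ 2 := by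
  rw [sq n.divisors.card, ← mul_assoc]
  have hdvd : ∀ p ∈ s, Int.gcd p.1 p.2 ^ 2 ∣ n := by
    intro p hp
    have h1 : ((Int.gcd p.1 p.2 : ℤ)) ^ 2 ∣ n := by
      rw [← hs p hp]
      exact dvd_add (pow_dvd_pow_of_dvd (Int.gcd_dvd_left _ _) 2)
        ((pow_dvd_pow_of_dvd (Int.gcd_dvd_right _ _) 2).mul_left _)
    exact_mod_cast h1
  refine Finset.card_le_mul_card_image_of_maps_to
    (f := fun p : ℤ × ℤ => Int.gcd p.1 p.2) ?_ _ ?_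
  · intro p hp
    exact Nat.mem_divisors.mpr ⟨(dvd_pow_self _ two_ne_zero).trans (hdvd p hp), hn⟩
  intro k hk
  have hk0 : k ≠ 0 := (Nat.pos_of_mem_divisors hk).ne'
  have hkZ : (k : ℤ) ≠ 0 := by exact_mod_cast hk0
  rcases (s.filter fun p => Int.gcd p.1 p.2 = k).eq_empty_or_nonempty with he | ⟨p₁, hp₁⟩
  · simp [he]
  obtain ⟨n', hn'⟩ : k ^ 2 ∣ n := by
    obtain ⟨hp, hpk⟩ := Finset.mem_filter.mp hp₁
    exact hpk ▸ hdvd p₁ hp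
  have hn'0 : n' ≠ 0 := by rintro rfl; simp at hn'; exact hn hn'
  have hn'Z : (n : ℤ) = k ^ 2 * n' := by exact_mod_cast hn'
  have hmul : ∀ p : ℤ × ℤ, Int.gcd p.1 p.2 = k → k * (p.1 / k) = p.1 ∧ k * (p.2 / k) = p.2 := by
    rintro p rfl
    exact ⟨Int.mul_ediv_cancel' (Int.gcd_dvd_left _ _), Int.mul_ediv_cancel' (Int.gcd_dvd_right _ _)⟩
  have hinj : Set.InjOn (fun p : ℤ × ℤ => (p.1 / (k : ℤ), p.2 / (k : ℤ)))
      (s.filter fun p => Int.gcd p.1 p.2 = k) := by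
    intro p hp q hq hpq
    obtain ⟨a1, a2⟩ := hmul p (Finset.mem_filter.mp hp).2
    obtain ⟨b1, b2⟩ := hmul q (Finset.mem_filter.mp hq).2
    simp only [Prod.mk.injEq] at hpq
    exact Prod.ext (by rw [← a1, ← b1, hpq.1]) (by rw [← a2, ← b2, hpq.2])
  rw [← Finset.card_image_of_injOn hinj]
  refine (card_primitive_reps_le hd hn'0 _ ?_).trans
    (Nat.mul_le_mul_left _ (Finset.card_le_card (Nat.divisors_subset_of_dvd hn ⟨k ^ 2, ?_⟩)))
  · intro r hr
    obtain ⟨p, hp, rfl⟩ := Finset.mem_image.mp hr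
    obtain ⟨hps, hpk⟩ := Finset.mem_filter.mp hp
    obtain ⟨a1, a2⟩ := hmul p hpk
    constructor
    · refine mul_left_cancel₀ (pow_ne_zero 2 hkZ) ?_
      rw [← hn'Z, ← hs p hps]
      conv_rhs => rw [← a1, ← a2]
      ring
    · subst hpk
      exact Int.gcd_ediv_gcd_ediv_gcd (Nat.pos_of_ne_zero hk0)
  · rw [hn', mul_comm]

/-- A finite set of triples `(t, u, v)` containing all those with `1 ≤ |t| ≤ K`, `u²|t| ≤ K` and
`v²|t| ≤ K`. -/
noncomputable def hyperbolicTriples (K : ℕ) : Finset (ℤ × ℤ × ℤ) :=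
  (Finset.Icc 1 K).biUnion fun n =>
    ({(n : ℤ), -(n : ℤ)} : Finset ℤ) ×ˢ
      (Finset.Icc (-((K / n).sqrt : ℤ)) ((K / n).sqrt)) ×ˢ
        (Finset.Icc (-((K / n).sqrt : ℤ)) ((K / n).sqrt))

theorem mem_hyperbolicTriples {K : ℕ} {t u v : ℤ} (ht : t ≠ 0) (huv : u ≠ 0 ∨ v ≠ 0)
    (hu : |u ^ 2 * t| ≤ K) (hv : |v ^ 2 * t| ≤ K) : (t, u, v) ∈ hyperbolicTriples K := by
  have hn : 0 < t.natAbs := Int.natAbs_pos.mpr ht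
  have aux : ∀ w : ℤ, |w ^ 2 * t| ≤ K → w.natAbs ^ 2 * t.natAbs ≤ K := by
    intro w hw
    rw [Int.abs_eq_natAbs, Int.natAbs_mul, Int.natAbs_pow] at hw
    exact_mod_cast hw
  have hsqrt : ∀ w : ℤ, |w ^ 2 * t| ≤ K → w.natAbs ≤ (K / t.natAbs).sqrt := by
    intro w hw
    rw [Nat.le_sqrt', Nat.le_div_iff_mul_le hn]
    exact aux w hw
  have htK : ∀ w : ℤ, w ≠ 0 → |w ^ 2 * t| ≤ K → t.natAbs ≤ K := fun w hw0 hw =>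
    (Nat.le_mul_of_pos_left _ (pow_pos (Int.natAbs_pos.mpr hw0) 2)).trans (aux w hw)
  have h1 := hsqrt u hu
  have h2 := hsqrt v hv
  simp only [hyperbolicTriples, Finset.mem_biUnion, Finset.mem_product, Finset.mem_Icc,
    Finset.mem_insert, Finset.mem_singleton]
  refine ⟨t.natAbs, ⟨hn, huv.elim (fun h => htK u h hu) (fun h => htK v h hv)⟩, ?_, ?_, ?_⟩ <;>
    omega

theorem card_hyperbolicTriples_le (K : ℕ) :
    ((hyperbolicTriples K).card : ℝ) ≤ 18 * K * (1 + Real.log K) := by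
  have h1 : ((hyperbolicTriples K).card : ℝ) ≤ ∑ n ∈ Finset.Icc 1 K, 18 * (K : ℝ) * (n : ℝ)⁻¹ := by
    refine (Nat.cast_le.mpr Finset.card_biUnion_le).trans ?_
    rw [Nat.cast_sum]
    refine Finset.sum_le_sum fun n hn => ?_
    obtain ⟨hn1, hnK⟩ := Finset.mem_Icc.mp hn
    rw [Finset.card_product, Finset.card_product, Int.card_Icc]
    set r := (K / n).sqrt
    have hr : 1 ≤ r := Nat.le_sqrt.mpr (Nat.div_pos hnK hn1)
    have hr2 : r ^ 2 * n ≤ K := by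
      rw [← Nat.le_div_iff_mul_le hn1]; exact Nat.sqrt_le' _
    have hrn : ((r : ℤ) + 1 - -(r : ℤ)).toNat = 2 * r + 1 := by omega
    rw [hrn, ← div_eq_mul_inv, le_div_iff₀ (by exact_mod_cast hn1)]
    have h2 := Finset.card_le_two (a := (n : ℤ)) (b := -(n : ℤ))
    have h3 : (2 * r + 1) * (2 * r + 1) ≤ 9 * r ^ 2 := by nlinarith
    have h4 := Nat.mul_le_mul_right n (Nat.mul_le_mul h2 h3)
    have h5 : 2 * (9 * r ^ 2) * n ≤ 18 * K := by nlinarith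
    exact_mod_cast h4.trans h5
  have h2 : ∑ n ∈ Finset.Icc 1 K, 18 * (K : ℝ) * (n : ℝ)⁻¹ = 18 * K * (harmonic K : ℝ) := by
    rw [← Finset.mul_sum, harmonic_eq_sum_Icc]
    push_cast
    rfl
  rw [h2] at h1
  exact h1.trans (mul_le_mul_of_nonneg_left (harmonic_le_one_add_log K) (by positivity))

/-- The number of representations of an integer by `y² + d z²` with `|y|, |z| ≤ B` is
`O(B ^ ε)`, uniformly in the integer. -/
theorem exists_card_reps_le_rpow {d : ℕ} (hd : d ≠ 0) (ε : ℝ) (hε : 0 < ε) :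
    ∃ C : ℝ, 0 < C ∧ ∀ B : ℝ, 1 ≤ B → ∀ (N : ℤ) (s : Finset (ℤ × ℤ)),
      (∀ p ∈ s, p.1 ^ 2 + d * p.2 ^ 2 = N ∧ (|p.1| : ℝ) ≤ B ∧ (|p.2| : ℝ) ≤ B) →
        (s.card : ℝ) ≤ C * B ^ ε := by
  obtain ⟨C, hC, hdiv⟩ := exists_card_divisors_le_rpow (ε / 4) (by positivity)
  have hdR : (1 : ℝ) ≤ 1 + d := by linarith [(Nat.cast_nonneg d : (0 : ℝ) ≤ d)]
  have hK : (1 : ℝ) ≤ (8 * d + 1) ^ 2 * (C * (1 + d) ^ (ε / 4)) ^ 2 := by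
    have h1 : (1 : ℝ) ≤ 8 * d + 1 := by linarith
    have h2 : (1 : ℝ) ≤ (1 + d : ℝ) ^ (ε / 4) := Real.one_le_rpow hdR (by positivity)
    exact one_le_mul_of_one_le_of_one_le (one_le_pow₀ h1)
      (one_le_pow₀ (one_le_mul_of_one_le_of_one_le hC h2))
  refine ⟨_, zero_lt_one.trans_le hK, fun B hB N s hs => ?_⟩
  have hBε : 1 ≤ B ^ ε := Real.one_le_rpow hB hε.le
  rcases s.eq_empty_or_nonempty with rfl | ⟨p, hp⟩
  · simp only [Finset.card_empty, Nat.cast_zero]; positivity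
  have hd1 : (1 : ℤ) ≤ d := by exact_mod_cast Nat.pos_of_ne_zero hd
  obtain ⟨hpN, hy, hz⟩ := hs p hp
  have hN : 0 ≤ N := by rw [← hpN]; positivity
  lift N to ℕ using hN
  rcases eq_or_ne N 0 with rfl | hN0
  · have : s.card ≤ 1 := by
      have hzero : ∀ q ∈ s, q = (0, 0) := by
        intro q hq
        obtain ⟨h, -, -⟩ := hs q hq
        have h1 : q.1 ^ 2 = 0 := by
          push_cast at h; nlinarith [sq_nonneg q.1, sq_nonneg q.2]
        have h2 : q.2 ^ 2 = 0 := by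
          push_cast at h; nlinarith [sq_nonneg q.1, sq_nonneg q.2]
        exact Prod.ext (pow_eq_zero_iff two_ne_zero |>.mp h1) (pow_eq_zero_iff two_ne_zero |>.mp h2)
      exact Finset.card_le_one.mpr fun a ha b hb => (hzero a ha).trans (hzero b hb).symm
    calc (s.card : ℝ) ≤ 1 := by exact_mod_cast this
      _ ≤ _ := one_le_mul_of_one_le_of_one_le hK hBε
  have hNB : (N : ℝ) ≤ (1 + d) * B ^ 2 := by
    have h1 : (p.1 : ℝ) ^ 2 + d * (p.2 : ℝ) ^ 2 = N := by exact_mod_cast hpN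
    have h2 : (p.1 : ℝ) ^ 2 ≤ B ^ 2 := sq_le_sq' (abs_le.mp hy).1 (abs_le.mp hy).2
    have h3 : (p.2 : ℝ) ^ 2 ≤ B ^ 2 := sq_le_sq' (abs_le.mp hz).1 (abs_le.mp hz).2
    have h4 := mul_le_mul_of_nonneg_left h3 (Nat.cast_nonneg d : (0 : ℝ) ≤ d)
    linarith
  have hcard : (s.card : ℝ) ≤ (8 * d + 1) ^ 2 * (N.divisors.card : ℝ) ^ 2 := by
    exact_mod_cast card_reps_le hd hN0 s fun q hq => (hs q hq).1
  have hτ : (N.divisors.card : ℝ) ≤ C * ((1 + d) * B ^ 2) ^ (ε / 4) :=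
    (hdiv N hN0).trans (mul_le_mul_of_nonneg_left
      (Real.rpow_le_rpow (by positivity) hNB (by positivity)) (by linarith))
  have hBpow : ((B ^ 2) ^ (ε / 4)) ^ 2 = B ^ ε := by
    rw [← Real.rpow_natCast, ← Real.rpow_natCast, ← Real.rpow_mul (by positivity),
      ← Real.rpow_mul (by positivity)]
    congr 1
    push_cast
    ring
  calc (s.card : ℝ) ≤ (8 * d + 1) ^ 2 * (C * ((1 + d) * B ^ 2) ^ (ε / 4)) ^ 2 :=
        hcard.trans (by gcongr)
    _ = (8 * d + 1) ^ 2 * (C * (1 + d) ^ (ε / 4)) ^ 2 * B ^ ε := by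
        rw [Real.mul_rpow (by positivity) (by positivity), ← hBpow]; ring

/-- For `a < 0`, the counting function of pairs of primitive vectors `(y,z,t) ∈ ℤ³`,
`(u,v) ∈ ℤ²` with `max(|v²t|,|uvt|,|u²t|,|y|,|z|) ≤ B` and `y² - a z² = t² F(u,v)`
is `O_ε(B^{1+ε})`; in particular its growth rate is at most `1`. -/
theorem chatelet_growth_rate_le_one
    (a : ℤ) (ha : ¬ IsSquare a) (haneg : a < 0)
    (f : Polynomial ℤ) (hdeg : f.natDegree = 3 ∨ f.natDegree = 4)
    (hsf : Squarefree (f.map (Int.castRingHom ℚ))) :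
    ∀ ε : ℝ, 0 < ε → ∃ C : ℝ, 0 < C ∧ ∀ B : ℝ, 2 ≤ B →
      ({q : (ℤ × ℤ × ℤ) × ℤ × ℤ |
          Int.gcd q.1.1 (Int.gcd q.1.2.1 q.1.2.2) = 1 ∧
          Int.gcd q.2.1 q.2.2 = 1 ∧
          ((max (max (max (max |q.2.2 ^ 2 * q.1.2.2| |q.2.1 * q.2.2 * q.1.2.2|)
              |q.2.1 ^ 2 * q.1.2.2|) |q.1.1|) |q.1.2.1| : ℤ) : ℝ) ≤ B ∧
          q.1.1 ^ 2 - a * q.1.2.1 ^ 2 = q.1.2.2 ^ 2 * binQuartic f q.2.1 q.2.2}.ncard : ℝ)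
        ≤ C * B ^ (1 + ε) := by
  intro ε hε
  obtain ⟨d, hd⟩ : ∃ d : ℕ, (d : ℤ) = -a := ⟨a.natAbs, by omega⟩
  have hd0 : d ≠ 0 := by omega
  obtain ⟨C, hC, hreps⟩ := exists_card_reps_le_rpow hd0 (ε / 2) (by positivity)
  refine ⟨C * (18 * (1 + 2 / ε)), by positivity, fun B hB => ?_⟩
  set S := {q : (ℤ × ℤ × ℤ) × ℤ × ℤ | _} with hS
  set K := ⌊B⌋₊
  have hmem : ∀ q ∈ S, q.1.2.2 ≠ 0 ∧ (q.2.1 ≠ 0 ∨ q.2.2 ≠ 0) ∧ |q.2.1 ^ 2 * q.1.2.2| ≤ K ∧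
      |q.2.2 ^ 2 * q.1.2.2| ≤ K ∧ |q.1.1| ≤ K ∧ |q.1.2.1| ≤ K ∧
      q.1.1 ^ 2 + d * q.1.2.1 ^ 2 = q.1.2.2 ^ 2 * binQuartic f q.2.1 q.2.2 := by
    rintro ⟨⟨y, z, t⟩, u, v⟩ ⟨hg, hg', hmax, heq⟩
    simp only at hg hg' hmax heq ⊢
    have hmax' := Int.le_floor.mpr hmax
    rw [← Int.natCast_floor_eq_floor (by linarith : (0 : ℝ) ≤ B)] at hmax'
    simp only [max_le_iff] at hmax'
    obtain ⟨⟨⟨⟨h1, -⟩, h2⟩, h3⟩, h4⟩ := hmax'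
    refine ⟨?_, ?_, h2, h1, h3, h4, by rw [hd, ← heq]; ring⟩
    · rintro rfl
      have hy : y ^ 2 = 0 := by nlinarith [sq_nonneg y, sq_nonneg z]
      have hz : z ^ 2 = 0 := by nlinarith [sq_nonneg y, sq_nonneg z]
      rw [pow_eq_zero_iff two_ne_zero] at hy hz
      simp [hy, hz] at hg
    · by_contra! h
      simp [h.1, h.2] at hg'
  have hfin : S.Finite := by
    have htr := (hyperbolicTriples K).finite_toSet
    have hbox := (Set.finite_Icc (-(K : ℤ)) K).prod (Set.finite_Icc (-(K : ℤ)) K)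
    refine Set.Finite.of_finite_image ((hbox.prod htr).subset ?_)
      (f := fun q => ((q.1.1, q.1.2.1), (q.1.2.2, q.2.1, q.2.2))) ?_
    · rintro _ ⟨q, hq, rfl⟩
      obtain ⟨h1, h2, h3, h4, h5, h6, -⟩ := hmem q hq
      exact ⟨⟨abs_le.mp h5, abs_le.mp h6⟩, mem_hyperbolicTriples h1 h2 h3 h4⟩
    · rintro ⟨⟨y, z, t⟩, u, v⟩ _ ⟨⟨y', z', t'⟩, u', v'⟩ _ h
      simp only [Prod.mk.injEq] at h ⊢
      tauto
  rw [Set.ncard_eq_toFinset_card S hfin]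
  have hKB : (K : ℝ) ≤ B := Nat.floor_le (by linarith)
  have hfib := Finset.card_le_mul_card_image_of_maps_to (s := hfin.toFinset)
    (t := hyperbolicTriples K) (f := fun q => (q.1.2.2, q.2.1, q.2.2)) (by
      intro q hq
      obtain ⟨h1, h2, h3, h4, -⟩ := hmem q (hfin.mem_toFinset.mp hq)
      exact mem_hyperbolicTriples h1 h2 h3 h4) ⌊C * B ^ (ε / 2)⌋₊ (by
      rintro ⟨t, u, v⟩ -
      refine Nat.le_floor ?_
      have hinj : Set.InjOn (fun q : (ℤ × ℤ × ℤ) × ℤ × ℤ => (q.1.1, q.1.2.1))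
          (hfin.toFinset.filter fun q => (q.1.2.2, q.2.1, q.2.2) = (t, u, v)) := by
        rintro ⟨⟨y, z, t⟩, u, v⟩ hq ⟨⟨y', z', t'⟩, u', v'⟩ hq' h
        have h1 := (Finset.mem_filter.mp hq).2
        have h2 := (Finset.mem_filter.mp hq').2
        simp only [Prod.mk.injEq] at h h1 h2 ⊢
        omega
      rw [← Finset.card_image_of_injOn hinj]
      refine hreps B (by linarith) (t ^ 2 * binQuartic f u v) _ fun p hp => ?_
      obtain ⟨q, hq, rfl⟩ := Finset.mem_image.mp hp
      obtain ⟨hqS, hqt⟩ := Finset.mem_filter.mp hq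
      obtain ⟨-, -, -, -, h5, h6, h7⟩ := hmem q (hfin.mem_toFinset.mp hqS)
      simp only [Prod.mk.injEq] at hqt
      obtain ⟨rfl, rfl, rfl⟩ := hqt
      exact ⟨h7, le_trans (by exact_mod_cast h5) hKB, le_trans (by exact_mod_cast h6) hKB⟩)
  have hBpos : 0 < B := by linarith
  have hK1 : 1 ≤ K := Nat.le_floor (by norm_num; linarith)
  have hlog : 1 + Real.log K ≤ (1 + 2 / ε) * B ^ (ε / 2) := by
    have h1 : Real.log K ≤ Real.log B := Real.log_le_log (by exact_mod_cast hK1) hKB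
    have h2 := Real.log_le_rpow_div hBpos.le (half_pos hε)
    have h3 : 1 ≤ B ^ (ε / 2) := Real.one_le_rpow (by linarith) (by positivity)
    have h4 : B ^ (ε / 2) / (ε / 2) = 2 / ε * B ^ (ε / 2) := by field_simp
    linarith
  have hlog0 : 0 ≤ 1 + Real.log K := by positivity
  calc (hfin.toFinset.card : ℝ)
      ≤ (⌊C * B ^ (ε / 2)⌋₊ : ℝ) * (hyperbolicTriples K).card := by exact_mod_cast hfib
    _ ≤ C * B ^ (ε / 2) * (18 * B * ((1 + 2 / ε) * B ^ (ε / 2))) := by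
        have h1 := Nat.floor_le (show 0 ≤ C * B ^ (ε / 2) by positivity)
        have h2 : ((hyperbolicTriples K).card : ℝ) ≤ 18 * B * ((1 + 2 / ε) * B ^ (ε / 2)) :=
          (card_hyperbolicTriples_le K).trans
            (mul_le_mul (by linarith) hlog hlog0 (by positivity))
        exact mul_le_mul h1 h2 (by positivity) (by positivity)
    _ = C * (18 * (1 + 2 / ε)) * B ^ (1 + ε) := by
        rw [show 1 + ε = 1 + (ε / 2 + ε / 2) by ring, Real.rpow_add hBpos, Real.rpow_add hBpos,
          Real.rpow_one]
        ring
end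

section
/- Write f(x) = c₀x⁴ + c₁x³ + c₂x² + c₃x + c₄ with integers c₀,…,c₄, and set Q(x₀,x₁,x₂) = c₄x₀² + c₃x₀x₁ + c₂x₀x₂ + c₁x₁x₂ + c₀x₂². Then for every real B > 0, twice the number of primitive vectors (x₀,x₁,x₂,x₃,x₄) ∈ ℤ⁵ satisfying x₀x₂ = x₁², x₃² − a·x₄² = Q(x₀,x₁,x₂) and max(|x₀|,|x₁|,|x₂|,|x₃|,|x₄|) ≤ B equals the number of pairs ((y,z,t),(u,v)) with (y,z,t) ∈ ℤ³ primitive, (u,v) ∈ ℤ² primitive, max(|v²t|, |uvt|, |u²t|, |y|, |z|) ≤ B and y² − a·z² = t²·F(u,v). -/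
/-- The quadratic form `Q(x₀,x₁,x₂) = c₄x₀² + c₃x₀x₁ + c₂x₀x₂ + c₁x₁x₂ + c₀x₂²`, where
`f(x) = c₀x⁴ + c₁x³ + c₂x² + c₃x + c₄`, i.e. `cᵢ = f.coeff (4 - i)`. -/
noncomputable def quadQ (f : Polynomial ℤ) (x₀ x₁ x₂ : ℤ) : ℤ :=
  f.coeff 0 * x₀ ^ 2 + f.coeff 1 * x₀ * x₁ + f.coeff 2 * x₀ * x₂ +
    f.coeff 3 * x₁ * x₂ + f.coeff 4 * x₂ ^ 2

/-- The pair `(u, v)` is lexicographically positive. -/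
def LexPos (u v : ℤ) : Prop := 0 < u ∨ u = 0 ∧ 0 < v

lemma lexPos_neg_iff {u v : ℤ} (h : u ≠ 0 ∨ v ≠ 0) : LexPos (-u) (-v) ↔ ¬ LexPos u v := by
  unfold LexPos
  omega

lemma quadQ_veronese (f : Polynomial ℤ) (u v t : ℤ) :
    quadQ f (v ^ 2 * t) (u * v * t) (u ^ 2 * t) = t ^ 2 * binQuartic f u v := by
  simp only [quadQ, binQuartic, Finset.sum_range_succ, Finset.sum_range_zero]
  norm_num
  ring

lemma eq_zero_of_sq_sub_mul_sq_eq_zero {a y z : ℤ} (ha : ¬ IsSquare a)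
    (h : y ^ 2 - a * z ^ 2 = 0) : y = 0 ∧ z = 0 := by
  have hz : z = 0 := by
    by_contra hz
    have hdvd : z ^ 2 ∣ y ^ 2 := ⟨a, by linarith⟩
    obtain ⟨k, rfl⟩ := (Int.pow_dvd_pow_iff two_ne_zero).1 hdvd
    refine ha ⟨k, mul_right_cancel₀ (pow_ne_zero 2 hz) ?_⟩
    linarith
  subst hz
  exact ⟨by simpa using h, rfl⟩

lemma gcd_veronese {u v : ℤ} (h : IsCoprime u v) (y z t : ℤ) :
    Int.gcd (v ^ 2 * t) (Int.gcd (u * v * t) (Int.gcd (u ^ 2 * t) (Int.gcd y z))) =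
      Int.gcd y (Int.gcd z t) := by
  obtain ⟨α, β, hαβ⟩ := h
  have ht : t = α ^ 2 * (u ^ 2 * t) + 2 * α * β * (u * v * t) + β ^ 2 * (v ^ 2 * t) := by
    linear_combination (-t * (α * u + β * v + 1)) * hαβ
  refine Nat.dvd_antisymm ?_ ?_
  · set g := Int.gcd (v ^ 2 * t) (Int.gcd (u * v * t) (Int.gcd (u ^ 2 * t) (Int.gcd y z)))
    have h₀ : (g : ℤ) ∣ v ^ 2 * t := Int.gcd_dvd_left _ _
    have h₁₂ : (g : ℤ) ∣ Int.gcd (u * v * t) (Int.gcd (u ^ 2 * t) (Int.gcd y z)) :=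
      Int.gcd_dvd_right _ _
    simp only [Int.dvd_coe_gcd_iff] at h₁₂
    obtain ⟨h₁, h₂, hy, hz⟩ := h₁₂
    have hgt : (g : ℤ) ∣ t := by
      rw [ht]
      exact dvd_add (dvd_add (h₂.mul_left _) (h₁.mul_left _)) (h₀.mul_left _)
    exact Int.dvd_gcd hy (Int.dvd_coe_gcd hz hgt)
  · set g := Int.gcd y (Int.gcd z t)
    have hy : (g : ℤ) ∣ y := Int.gcd_dvd_left _ _
    have hzt : (g : ℤ) ∣ Int.gcd z t := Int.gcd_dvd_right _ _
    obtain ⟨hz, hgt⟩ := Int.dvd_coe_gcd_iff.1 hzt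
    exact Int.dvd_gcd (hgt.mul_left _) (Int.dvd_coe_gcd (hgt.mul_left _)
      (Int.dvd_coe_gcd (hgt.mul_left _) (Int.dvd_coe_gcd hy hz)))

/-- A primitive pair and a scalar are determined by the point
`(v²t, uvt, u²t)` up to the sign of the pair. -/
lemma eq_or_neg_of_veronese_eq {u v t u' v' t' : ℤ} (h : IsCoprime u v) (h' : IsCoprime u' v')
    (ht : t ≠ 0) (h₀ : v ^ 2 * t = v' ^ 2 * t') (h₁ : u * v * t = u' * v' * t')
    (h₂ : u ^ 2 * t = u' ^ 2 * t') :
    t = t' ∧ (u = u' ∧ v = v' ∨ u = -u' ∧ v = -v') := by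
  obtain ⟨α, β, hαβ⟩ := h
  obtain ⟨α', β', hαβ'⟩ := h'
  have e : t = t' * (α * u' + β * v') ^ 2 := by
    linear_combination (-t * (α * u + β * v + 1)) * hαβ + α ^ 2 * h₂ + 2 * α * β * h₁ + β ^ 2 * h₀
  have e' : t' = t * (α' * u + β' * v) ^ 2 := by
    linear_combination (-t' * (α' * u' + β' * v' + 1)) * hαβ' - α' ^ 2 * h₂ -
      2 * α' * β' * h₁ - β' ^ 2 * h₀
  have htt : t = t' := by
    generalize α * u' + β * v' = s at e
    generalize α' * u + β' * v = s' at e'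
    have hs : s' ^ 2 * s ^ 2 = 1 := mul_left_cancel₀ ht (by rw [← mul_assoc, ← e', ← e, mul_one])
    rw [Int.eq_one_of_mul_eq_one_right (sq_nonneg s') hs, mul_one] at e'
    exact e'.symm
  subst htt
  have k₀ := mul_right_cancel₀ ht h₀
  have k₁ := mul_right_cancel₀ ht h₁
  have k₂ := mul_right_cancel₀ ht h₂
  refine ⟨rfl, ?_⟩
  have p : u = (α * u' + β * v') * u' := by
    linear_combination (-u) * hαβ + α * k₂ + β * k₁
  have q : v = (α * u' + β * v') * v' := by
    linear_combination (-v) * hαβ + α * k₁ + β * k₀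
  have hs : (α * u' + β * v') ^ 2 = 1 := by
    refine mul_left_cancel₀ ht ?_
    linear_combination -e
  rcases sq_eq_one_iff.1 hs with hs | hs <;> rw [hs] at p q
  · exact .inl ⟨by linarith, by linarith⟩
  · exact .inr ⟨by linarith, by linarith⟩

lemma exists_sq_of_mul_eq_sq {p q r : ℤ} (h : Int.gcd p q = 1) (hr : p * q = r ^ 2) :
    ∃ u v e : ℤ, p = v ^ 2 * e ∧ r = u * v * e ∧ q = u ^ 2 * e := by
  have key : ∃ u v e : ℤ, (e = 1 ∨ e = -1) ∧ p = v ^ 2 * e ∧ q = u ^ 2 * e := by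
    obtain ⟨v, hv⟩ := Int.sq_of_gcd_eq_one h hr
    obtain ⟨u, hu⟩ := Int.sq_of_gcd_eq_one (by rwa [Int.gcd_comm]) (by rwa [mul_comm])
    have mixed : p * q = -(u * v) ^ 2 → u = 0 ∨ v = 0 := fun hm =>
      mul_eq_zero.1 (pow_eq_zero_iff two_ne_zero |>.1
        (le_antisymm (by nlinarith [sq_nonneg r]) (sq_nonneg (u * v))))
    rcases hv with hv | hv <;> rcases hu with hu | hu
    · exact ⟨u, v, 1, by simp, by linarith, by linarith⟩
    · rcases mixed (by rw [hv, hu]; ring) with rfl | rfl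
      · exact ⟨0, v, 1, by simp, by linarith, by linarith⟩
      · exact ⟨u, 0, -1, by simp, by linarith, by linarith⟩
    · rcases mixed (by rw [hv, hu]; ring) with rfl | rfl
      · exact ⟨0, v, -1, by simp, by linarith, by linarith⟩
      · exact ⟨u, 0, 1, by simp, by linarith, by linarith⟩
    · exact ⟨u, v, -1, by simp, by linarith, by linarith⟩
  obtain ⟨u, v, e, -, hp, hq⟩ := key
  have hs : r ^ 2 = (u * v * e) ^ 2 := by rw [← hr, hp, hq]; ring
  rcases sq_eq_sq_iff_eq_or_eq_neg.1 hs with hs | hs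
  · exact ⟨u, v, e, hp, hs, hq⟩
  · exact ⟨-u, v, e, hp, by rw [hs]; ring, by rw [hq]; ring⟩

/-- Every nonzero integer point of the conic cone `x₀x₂ = x₁²` has the form
`(v²t, uvt, u²t)` with `(u, v)` primitive. -/
lemma exists_veronese {x₀ x₁ x₂ : ℤ} (h : x₀ * x₂ = x₁ ^ 2) (hne : x₀ ≠ 0 ∨ x₂ ≠ 0) :
    ∃ u v t : ℤ, IsCoprime u v ∧ x₀ = v ^ 2 * t ∧ x₁ = u * v * t ∧ x₂ = u ^ 2 * t := by
  have hg : 0 < Int.gcd x₀ x₂ := Int.gcd_pos_iff.2 hne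
  obtain ⟨p, q, hpq, hp, hq⟩ := Int.exists_gcd_one hg
  generalize ((Int.gcd x₀ x₂ : ℕ) : ℤ) = d at hp hq
  have hdvd : d ^ 2 ∣ x₁ ^ 2 := ⟨p * q, by rw [← h, hp, hq]; ring⟩
  obtain ⟨r, rfl⟩ := (Int.pow_dvd_pow_iff two_ne_zero).1 hdvd
  have hd : d ≠ 0 := by
    rintro rfl
    simp_all
  have hr : p * q = r ^ 2 := by
    refine mul_left_cancel₀ (pow_ne_zero 2 hd) ?_
    rw [hp, hq] at h
    linear_combination h
  obtain ⟨u, v, e, hv, huv, hu⟩ := exists_sq_of_mul_eq_sq hpq hr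
  refine ⟨u, v, e * d, ?_, by rw [hp, hv]; ring, by rw [huv]; ring, by rw [hq, hu]; ring⟩
  rw [← Int.isCoprime_iff_gcd_eq_one, hv, hu] at hpq
  exact ((IsCoprime.pow_iff two_pos two_pos).1 hpq.of_mul_left_left.of_mul_right_left).symm

/-- Lemma 2: twice the number of primitive integer points of height at most `B` on the
quartic del Pezzo surface `x₀x₂ = x₁²`, `x₃² - a x₄² = Q(x₀,x₁,x₂)` equals the number of
pairs of primitive vectors `(y,z,t) ∈ ℤ³`, `(u,v) ∈ ℤ²` with
`max(|v²t|,|uvt|,|u²t|,|y|,|z|) ≤ B` and `y² - a z² = t² F(u,v)`. -/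
theorem delPezzo_count_eq_torsor_count
    (a : ℤ) (ha : ¬ IsSquare a)
    (f : Polynomial ℤ) (hdeg : f.natDegree = 3 ∨ f.natDegree = 4)
    (hsf : Squarefree (f.map (Int.castRingHom ℚ))) :
    ∀ B : ℝ, 0 < B →
      2 * {x : ℤ × ℤ × ℤ × ℤ × ℤ |
          Int.gcd x.1 (Int.gcd x.2.1 (Int.gcd x.2.2.1 (Int.gcd x.2.2.2.1 x.2.2.2.2))) = 1 ∧
          x.1 * x.2.2.1 = x.2.1 ^ 2 ∧
          x.2.2.2.1 ^ 2 - a * x.2.2.2.2 ^ 2 = quadQ f x.1 x.2.1 x.2.2.1 ∧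
          ((max (max (max (max |x.1| |x.2.1|) |x.2.2.1|) |x.2.2.2.1|) |x.2.2.2.2| : ℤ) : ℝ)
            ≤ B}.ncard =
      {q : (ℤ × ℤ × ℤ) × ℤ × ℤ |
          Int.gcd q.1.1 (Int.gcd q.1.2.1 q.1.2.2) = 1 ∧
          Int.gcd q.2.1 q.2.2 = 1 ∧
          ((max (max (max (max |q.2.2 ^ 2 * q.1.2.2| |q.2.1 * q.2.2 * q.1.2.2|)
              |q.2.1 ^ 2 * q.1.2.2|) |q.1.1|) |q.1.2.1| : ℤ) : ℝ) ≤ B ∧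
          q.1.1 ^ 2 - a * q.1.2.1 ^ 2 = q.1.2.2 ^ 2 * binQuartic f q.2.1 q.2.2}.ncard := by
  classical
  intro B _
  set S := {x : ℤ × ℤ × ℤ × ℤ × ℤ | _}
  set T := {q : (ℤ × ℤ × ℤ) × ℤ × ℤ | _}
  have hcard : 2 * S.ncard = (S ×ˢ (Set.univ : Set Bool)).ncard := by
    rw [Set.ncard_prod, Set.ncard_univ, Nat.card_eq_fintype_card, Fintype.card_bool, mul_comm]
  rw [hcard]
  symm
  have ht_ne : ∀ q ∈ T, q.1.2.2 ≠ 0 := by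
    rintro ⟨⟨y, z, t⟩, u, v⟩ ⟨hg, -, -, he⟩ (rfl : t = 0)
    obtain ⟨rfl, rfl⟩ := eq_zero_of_sq_sub_mul_sq_eq_zero (y := y) (z := z) ha (by simpa using he)
    simp at hg
  refine Set.ncard_congr (fun q _ => ((q.2.2 ^ 2 * q.1.2.2, q.2.1 * q.2.2 * q.1.2.2,
    q.2.1 ^ 2 * q.1.2.2, q.1.1, q.1.2.1), decide (LexPos q.2.1 q.2.2))) ?_ ?_ ?_
  · rintro ⟨⟨y, z, t⟩, u, v⟩ ⟨hg, huv, hB, he⟩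
    refine ⟨⟨?_, ?_, ?_, hB⟩, Set.mem_univ _⟩
    · exact (gcd_veronese (Int.isCoprime_iff_gcd_eq_one.2 huv) y z t).trans hg
    · dsimp only
      ring
    · exact he.trans (quadQ_veronese f u v t).symm
  · rintro ⟨⟨y, z, t⟩, u, v⟩ ⟨⟨y', z', t'⟩, u', v'⟩ hq hq' heq
    have ht := ht_ne _ hq
    have huv := Int.isCoprime_iff_gcd_eq_one.2 hq.2.1
    have huv' := Int.isCoprime_iff_gcd_eq_one.2 hq'.2.1
    simp only [Prod.mk.injEq, decide_eq_decide] at heq ht huv huv'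
    obtain ⟨⟨h₀, h₁, h₂, rfl, rfl⟩, hpos⟩ := heq
    obtain ⟨rfl, ⟨rfl, rfl⟩ | ⟨rfl, rfl⟩⟩ := eq_or_neg_of_veronese_eq huv huv' ht h₀ h₁ h₂
    · rfl
    · rw [lexPos_neg_iff huv'.ne_zero_or_ne_zero] at hpos
      exact absurd hpos (by tauto)
  · rintro ⟨⟨x₀, x₁, x₂, y, z⟩, b⟩ ⟨⟨hg, hx, he, hB⟩, -⟩
    dsimp only at hg hx he hB
    have hne : x₀ ≠ 0 ∨ x₂ ≠ 0 := by
      by_contra! h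
      obtain ⟨rfl, rfl⟩ := h
      obtain rfl : x₁ = 0 := by simpa using hx.symm
      obtain ⟨rfl, rfl⟩ := eq_zero_of_sq_sub_mul_sq_eq_zero ha (by simpa [quadQ] using he)
      simp at hg
    obtain ⟨u, v, t, huv, rfl, rfl, rfl⟩ := exists_veronese hx hne
    have hmem : ∀ u' v' : ℤ, IsCoprime u' v' → v' ^ 2 = v ^ 2 → u' * v' = u * v →
        u' ^ 2 = u ^ 2 → ((y, z, t), u', v') ∈ T := by
      intro u' v' huv' h₀ h₁ h₂
      refine ⟨?_, Int.isCoprime_iff_gcd_eq_one.1 huv', ?_, ?_⟩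
      · exact (gcd_veronese huv y z t).symm.trans hg
      · dsimp only
        rwa [h₀, h₁, h₂]
      · dsimp only
        rw [he, ← quadQ_veronese, h₀, h₁, h₂]
    by_cases hb : decide (LexPos u v) = b
    · exact ⟨((y, z, t), u, v), hmem u v huv rfl rfl rfl, by simp [hb]⟩
    · refine ⟨((y, z, t), -u, -v), hmem _ _ huv.neg_neg (by ring) (by ring) (by ring), ?_⟩
      have hn := lexPos_neg_iff huv.ne_zero_or_ne_zero
      cases b <;> simp_all
end

section
/- Every triple (x₀,x₁,x₂) ∈ ℤ³ with (x₀,x₁,x₂) ≠ (0,0,0) and x₀x₂ = x₁² admits exactly two triples (t,u,v) ∈ ℤ³ with gcd(u,v) = 1 and (x₀,x₁,x₂) = (t·v², t·u·v, t·u²). -/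
/-- A nonzero solution of `x₀x₂ = x₁²` is parametrized by a triple with coprime `(u, v)`. -/
theorem exists_conic_parametrization {x₀ x₁ x₂ : ℤ} (h : x₀ * x₂ = x₁ ^ 2) :
    ∃ t u v : ℤ, IsCoprime u v ∧ x₀ = t * v ^ 2 ∧ x₁ = t * u * v ∧ x₂ = t * u ^ 2 := by
  by_cases h0 : x₀ = 0
  · subst h0
    have h1 : x₁ = 0 := by
      rw [zero_mul] at h
      exact pow_eq_zero_iff two_ne_zero |>.1 h.symm
    exact ⟨x₂, 1, 0, isCoprime_one_left, by simp, by simp [h1], by simp⟩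
  · obtain ⟨d, v, u, hd, hvu, hv, hu⟩ :
        ∃ d v u : ℤ, d ≠ 0 ∧ IsCoprime u v ∧ x₀ = v * d ∧ x₁ = u * d := by
      obtain ⟨v, u, hvu, hv, hu⟩ := Int.exists_gcd_one (Int.gcd_pos_of_ne_zero_left x₁ h0)
      refine ⟨_, v, u, ?_, (Int.isCoprime_iff_gcd_eq_one.2 hvu).symm, hv, hu⟩
      exact_mod_cast (Int.gcd_pos_of_ne_zero_left x₁ h0).ne'
    have hv0 : v ≠ 0 := by
      rintro rfl
      exact h0 (by simpa using hv)
    have hx : v * x₂ = d * u ^ 2 := by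
      apply mul_left_cancel₀ hd
      rw [hv, hu] at h
      linear_combination h
    obtain ⟨t, rfl⟩ : v ∣ d := hvu.symm.pow_right.dvd_of_dvd_mul_right ⟨x₂, hx.symm⟩
    refine ⟨t, u, v, hvu, by rw [hv]; ring, by rw [hu]; ring, ?_⟩
    apply mul_left_cancel₀ hv0
    linear_combination hx

theorem conic_scale_dvd {t u v t' u' v' : ℤ} (huv : IsCoprime u v)
    (h0 : t * v ^ 2 = t' * v' ^ 2) (h2 : t * u ^ 2 = t' * u' ^ 2) : t' ∣ t := by
  obtain ⟨a, b, hab⟩ := huv.pow (m := 2) (n := 2)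
  exact ⟨a * u' ^ 2 + b * v' ^ 2, by linear_combination (-t) * hab + a * h2 + b * h0⟩

theorem conic_scale_eq {t u v t' u' v' : ℤ} (huv : IsCoprime u v) (huv' : IsCoprime u' v')
    (h0 : t * v ^ 2 = t' * v' ^ 2) (h2 : t * u ^ 2 = t' * u' ^ 2) : t = t' := by
  have hdvd := conic_scale_dvd huv h0 h2
  have hdvd' := conic_scale_dvd huv' h0.symm h2.symm
  rcases Int.natAbs_eq_natAbs_iff.1 (Int.natAbs_eq_of_dvd_dvd hdvd' hdvd) with ht | ht
  · exact ht
  have hpos : 0 < u ^ 2 + v ^ 2 := by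
    rcases huv.ne_zero_or_ne_zero with hu | hv <;> positivity
  have hsum : t' * (u ^ 2 + v ^ 2 + (u' ^ 2 + v' ^ 2)) = 0 := by
    rw [ht] at h0 h2
    linear_combination -h0 - h2
  have ht' : t' = 0 := (mul_eq_zero.1 hsum).resolve_right (by positivity)
  simp [ht, ht']

/-- Two integer pairs with the same squares and product agree up to a common sign. -/
theorem pair_eq_or_eq_neg {u v u' v' : ℤ} (hu : u ^ 2 = u' ^ 2) (hv : v ^ 2 = v' ^ 2)
    (huv : u * v = u' * v') : (u = u' ∧ v = v') ∨ (u = -u' ∧ v = -v') := by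
  rcases sq_eq_sq_iff_eq_or_eq_neg.1 hu with rfl | rfl <;>
    rcases sq_eq_sq_iff_eq_or_eq_neg.1 hv with rfl | rfl
  · simp
  · have : u = 0 ∨ v' = 0 := mul_eq_zero.1 (by linarith)
    rcases this with rfl | rfl <;> simp
  · have : u' = 0 ∨ v = 0 := mul_eq_zero.1 (by linarith)
    rcases this with rfl | rfl <;> simp
  · simp

/-- Every nonzero integer triple `(x₀,x₁,x₂)` with `x₀x₂ = x₁²` is of the form
`(tv², tuv, tu²)` with `gcd(u,v) = 1` in exactly two ways. -/
theorem two_parametrizations_of_conic_point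
    (x₀ x₁ x₂ : ℤ) (hne : (x₀, x₁, x₂) ≠ (0, 0, 0)) (h : x₀ * x₂ = x₁ ^ 2) :
    {p : ℤ × ℤ × ℤ | Int.gcd p.2.1 p.2.2 = 1 ∧
      x₀ = p.1 * p.2.2 ^ 2 ∧ x₁ = p.1 * p.2.1 * p.2.2 ∧ x₂ = p.1 * p.2.1 ^ 2}.ncard = 2 := by
  obtain ⟨t, u, v, huv, rfl, rfl, rfl⟩ := exists_conic_parametrization h
  have ht : t ≠ 0 := by
    rintro rfl
    simp at hne
  rw [Set.ncard_eq_two]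
  refine ⟨(t, u, v), (t, -u, -v), ?_, ?_⟩
  · intro heq
    simp only [Prod.mk.injEq, true_and] at heq
    rcases huv.ne_zero_or_ne_zero with hu | hv <;> lia
  · ext ⟨t', u', v'⟩
    simp only [Set.mem_ofPred_eq, Set.mem_insert_iff, Set.mem_singleton_iff, Prod.mk.injEq]
    constructor
    · rintro ⟨hgcd, h0, h1, h2⟩
      obtain rfl := conic_scale_eq huv (Int.isCoprime_iff_gcd_eq_one.2 hgcd) h0 h2
      have huv' : u' * v' = u * v := mul_left_cancel₀ ht (by linear_combination -h1)
      simpa using pair_eq_or_eq_neg (mul_left_cancel₀ ht h2).symm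
        (mul_left_cancel₀ ht h0).symm huv'
    · have hgcd := Int.isCoprime_iff_gcd_eq_one.1 huv
      rintro (⟨rfl, rfl, rfl⟩ | ⟨rfl, rfl, rfl⟩) <;> simp [hgcd]
end

section
/- Let a, m ∈ ℤ and let p be an odd prime such that p divides m but p² does not divide m. If there exist y, z, t ∈ ℤ with gcd(y,z,t) = 1 and y² − a·z² = t²·m, then the Legendre symbol (a/p) is not equal to −1; that is, a is congruent to a square modulo p. -/
/-- If `p` is an odd prime exactly dividing `m` and `y² - a z² = t² m` has a solution
with `gcd(y,z,t) = 1`, then the Legendre symbol `(a/p)` is not `-1`, i.e. `a` is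
congruent to a square modulo `p`. -/
theorem legendre_ne_neg_one_of_isotropic
    (a m : ℤ) (p : ℕ) [Fact p.Prime] (hp2 : p ≠ 2)
    (hpm : (p : ℤ) ∣ m) (hpm2 : ¬ ((p : ℤ) ^ 2 ∣ m))
    (h : ∃ y z t : ℤ, Int.gcd y (Int.gcd z t) = 1 ∧ y ^ 2 - a * z ^ 2 = t ^ 2 * m) :
    legendreSym p a ≠ -1 ∧ IsSquare ((a : ZMod p)) := by
  have hp : Prime (p : ℤ) := Nat.prime_iff_prime_int.mp Fact.out
  have hsq : IsSquare (a : ZMod p) := by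
    obtain ⟨y, z, t, hgcd, heq⟩ := h
    have hy2 : (p : ℤ) ∣ y ^ 2 - a * z ^ 2 := heq ▸ hpm.mul_left _
    by_cases hz : (p : ℤ) ∣ z
    · have hy : (p : ℤ) ∣ y := by
        refine hp.dvd_of_dvd_pow (n := 2) ?_
        have haz : (p : ℤ) ∣ a * z ^ 2 := (dvd_pow hz two_ne_zero).mul_left a
        exact (dvd_sub_left haz).mp hy2
      have hp2tm : (p : ℤ) ^ 2 ∣ t ^ 2 * m :=
        heq ▸ dvd_sub (pow_dvd_pow_of_dvd hy 2) ((pow_dvd_pow_of_dvd hz 2).mul_left a)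
      have ht : (p : ℤ) ∣ t := by
        by_contra ht
        exact hpm2 (((hp.coprime_iff_not_dvd.mpr ht).pow).dvd_of_dvd_mul_left hp2tm)
      have hdvd : (p : ℤ) ∣ Int.gcd y (Int.gcd z t) :=
        Int.dvd_coe_gcd hy (Int.dvd_coe_gcd hz ht)
      rw [hgcd] at hdvd
      exact absurd (isUnit_of_dvd_one (by exact_mod_cast hdvd)) hp.not_isUnit
    · have hz0 : (z : ZMod p) ≠ 0 := by rwa [Ne, ZMod.intCast_zmod_eq_zero_iff_dvd]
      have hmod : (y : ZMod p) ^ 2 - a * (z : ZMod p) ^ 2 = 0 := by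
        exact_mod_cast (ZMod.intCast_zmod_eq_zero_iff_dvd _ p).mpr hy2
      refine ⟨y / z, ?_⟩
      field_simp
      linear_combination -hmod
  exact ⟨fun hneg => (legendreSym.eq_neg_one_iff p).mp hneg hsq, hsq⟩
end

section
/- Let g ∈ ℤ[x] be a polynomial that is irreducible over ℚ and has nonzero discriminant, let a be an integer which is not a perfect square, and suppose that a is NOT a square in the field ℚ[x]/(g). Then there exist constants P₀ ≥ 2 and C > 0 (depending on a and g) such that for all real U ≥ 2, ∏_{P₀ < p ≤ U} (1 + ρ_g(p)·χ_a(p)/p) ≤ C, the product being over primes p in the indicated range. -/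
open Classical in
/-- `χ_a(p)`: the Legendre symbol `(a/p)` for an odd prime `p`, with `χ_a(2) = 0`. -/
noncomputable def chiA (a : ℤ) (p : ℕ) : ℝ :=
  if p = 2 then 0
  else if (a : ZMod p) = 0 then 0
  else if IsSquare ((a : ZMod p)) then 1 else -1

/-- `ρ_g(p)`: the number of roots of `g` modulo `p`. -/
noncomputable def rhoPoly (g : Polynomial ℤ) (p : ℕ) : ℕ :=
  Nat.card {x : ZMod p // Polynomial.aeval x g = 0}

open Finset in
theorem sum_primesLE_two_mul_sdiff_log_le (n : ℕ) :
    ∑ p ∈ Nat.primesLE (2 * n) \ Nat.primesLE n, Real.log p ≤ Real.log 4 * (2 * n) := by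
  have h1 : ∑ p ∈ Nat.primesLE (2 * n) \ Nat.primesLE n, Real.log p
      ≤ ∑ p ∈ Nat.primesLE (2 * n), Real.log p :=
    sum_le_sum_of_subset_of_nonneg sdiff_subset fun p _ _ ↦ Real.log_natCast_nonneg p
  rw [← Chebyshev.theta_eq_sum_primesLE_log] at h1
  refine h1.trans ((Chebyshev.theta_le_log4_mul_x (by positivity)).trans (le_of_eq ?_))
  push_cast; ring

theorem lt_of_mem_primesLE_sdiff {m n p : ℕ} (h : p ∈ Nat.primesLE m \ Nat.primesLE n) :
    p.Prime ∧ n < p := by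
  simp only [Finset.mem_sdiff, Nat.mem_primesLE] at h
  exact ⟨h.1.2, not_le.mp fun h' ↦ h.2 ⟨h', h.1.2⟩⟩

theorem sum_primesLE_two_pow_log_div_le (k : ℕ) :
    ∑ p ∈ Nat.primesLE (2 ^ k), Real.log p / p ≤ 2 * Real.log 4 * k := by
  induction k with
  | zero =>
    have : Nat.primesLE 1 = ∅ := by decide
    simp [this]
  | succ k ih =>
    have hsub : Nat.primesLE (2 ^ k) ⊆ Nat.primesLE (2 * 2 ^ k) := fun p hp ↦ by
      rw [Nat.mem_primesLE] at hp ⊢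
      exact ⟨by omega, hp.2⟩
    rw [pow_succ', ← Finset.sum_sdiff hsub]
    have hpos : (0 : ℝ) < 2 ^ k := by positivity
    have h2 : ∑ p ∈ Nat.primesLE (2 * 2 ^ k) \ Nat.primesLE (2 ^ k), Real.log p / p
        ≤ 2 * Real.log 4 := by
      calc _ ≤ ∑ p ∈ Nat.primesLE (2 * 2 ^ k) \ Nat.primesLE (2 ^ k), Real.log p / 2 ^ k := by
            refine Finset.sum_le_sum fun p hp ↦ ?_
            have := (lt_of_mem_primesLE_sdiff hp).2.le
            have h' : (2 : ℝ) ^ k ≤ p := by exact_mod_cast this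
            exact div_le_div_of_nonneg_left (Real.log_natCast_nonneg p) hpos h'
        _ ≤ Real.log 4 * (2 * (2 ^ k : ℕ)) / 2 ^ k := by
            rw [← Finset.sum_div]
            gcongr
            exact sum_primesLE_two_mul_sdiff_log_le _
        _ = 2 * Real.log 4 := by push_cast; field_simp
    push_cast
    linarith

/-- A weak form of Mertens' first theorem. -/
theorem exists_sum_primesLE_log_div_le :
    ∃ C : ℝ, 0 < C ∧ ∀ N : ℕ, 2 ≤ N →
      ∑ p ∈ Nat.primesLE N, Real.log p / p ≤ C * Real.log N := by
  have h4 : 0 < Real.log 4 := Real.log_pos (by norm_num)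
  have h2 : 0 < Real.log 2 := Real.log_pos (by norm_num)
  refine ⟨2 * Real.log 4 * (2 / Real.log 2), by positivity, fun N hN ↦ ?_⟩
  have hlt := Nat.lt_pow_succ_log_self (b := 2) (by norm_num) N
  have hle := Nat.pow_log_le_self 2 (x := N) (by omega)
  set k := Nat.log 2 N
  have hk : 1 ≤ k := Nat.log_pos (by norm_num) hN
  calc ∑ p ∈ Nat.primesLE N, Real.log p / p
      ≤ ∑ p ∈ Nat.primesLE (2 ^ (k + 1)), Real.log p / p := by
        refine Finset.sum_le_sum_of_subset_of_nonneg (fun p hp ↦ ?_) fun p _ _ ↦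
          div_nonneg (Real.log_natCast_nonneg p) (by positivity)
        rw [Nat.mem_primesLE] at hp ⊢
        exact ⟨by omega, hp.2⟩
    _ ≤ 2 * Real.log 4 * (k + 1 : ℕ) := sum_primesLE_two_pow_log_div_le _
    _ ≤ 2 * Real.log 4 * (2 / Real.log 2 * Real.log N) := by
        gcongr
        have h3 : k * Real.log 2 ≤ Real.log N := by
          rw [← Real.log_pow]
          exact Real.log_le_log (by positivity) (by exact_mod_cast hle)
        have h5 : (1 : ℝ) ≤ k := by exact_mod_cast hk
        rw [div_mul_eq_mul_div, le_div_iff₀ h2]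
        push_cast
        nlinarith
    _ = _ := by ring

theorem sum_primesLE_sdiff_rpow_le {N : ℕ} (hN : 2 ≤ N) {ε : ℝ} (hε : 0 < ε) (J : ℕ) :
    ∑ p ∈ Nat.primesLE (2 ^ J * N) \ Nat.primesLE N, (p : ℝ) ^ (-(1 + ε)) ≤
      2 * Real.log 4 / Real.log N * ∑ j ∈ Finset.range J, ((2 : ℝ) ^ (-ε)) ^ j := by
  have hNpos : (0 : ℝ) < N := by positivity
  have hlogN : 0 < Real.log N := Real.log_pos (by exact_mod_cast (by omega : 1 < N))
  have h4 : 0 < Real.log 4 := Real.log_pos (by norm_num)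
  induction J with
  | zero => simp
  | succ J ih =>
    rw [Finset.sum_range_succ, mul_add]
    set m := 2 ^ J * N with hm
    have hNm : N ≤ m := Nat.le_mul_of_pos_left _ (by positivity)
    have hmpos : (0 : ℝ) < m := by exact_mod_cast (by omega : 0 < m)
    rw [show 2 ^ (J + 1) * N = 2 * m by rw [hm]; ring]
    have hstep : ∑ p ∈ Nat.primesLE (2 * m) \ Nat.primesLE m, (p : ℝ) ^ (-(1 + ε)) ≤
        2 * Real.log 4 / Real.log N * ((2 : ℝ) ^ (-ε)) ^ J := by
      calc _ ≤ ∑ p ∈ Nat.primesLE (2 * m) \ Nat.primesLE m,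
              (m : ℝ) ^ (-(1 + ε)) / Real.log N * Real.log p := by
            refine Finset.sum_le_sum fun p hp ↦ ?_
            have hmp : (m : ℝ) < p := by exact_mod_cast (lt_of_mem_primesLE_sdiff hp).2
            have hNp : (N : ℝ) ≤ p := le_trans (by exact_mod_cast hNm) hmp.le
            have h1 : (p : ℝ) ^ (-(1 + ε)) ≤ (m : ℝ) ^ (-(1 + ε)) :=
              Real.rpow_le_rpow_of_nonpos hmpos hmp.le (by linarith)
            have h2 : Real.log N ≤ Real.log p := Real.log_le_log hNpos hNp
            rw [div_mul_eq_mul_div, le_div_iff₀ hlogN]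
            gcongr
        _ ≤ (m : ℝ) ^ (-(1 + ε)) / Real.log N * (Real.log 4 * (2 * m)) := by
            rw [← Finset.mul_sum]
            gcongr
            exact sum_primesLE_two_mul_sdiff_log_le _
        _ = 2 * Real.log 4 / Real.log N * (m : ℝ) ^ (-ε) := by
            rw [neg_add, Real.rpow_add hmpos, Real.rpow_neg_one]
            field_simp
        _ ≤ 2 * Real.log 4 / Real.log N * ((2 : ℝ) ^ (-ε)) ^ J := by
            gcongr
            rw [← Real.rpow_mul_natCast (by norm_num), mul_comm, Real.rpow_mul (by norm_num),
              Real.rpow_natCast]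
            refine Real.rpow_le_rpow_of_nonpos (by positivity) ?_ (by linarith)
            rw [hm]; push_cast
            have : (1 : ℝ) ≤ N := by exact_mod_cast (by omega : 1 ≤ N)
            exact le_mul_of_one_le_right (by positivity) this
    refine le_trans ?_ (add_le_add ih hstep)
    rw [← Finset.sum_union]
    · refine Finset.sum_le_sum_of_subset_of_nonneg (fun p hp ↦ ?_) fun p _ _ ↦ by positivity
      simp only [Finset.mem_union, Finset.mem_sdiff] at hp ⊢
      tauto
    · rw [Finset.disjoint_left]
      intro p hp hp'
      simp only [Finset.mem_sdiff] at hp hp'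
      exact hp'.2 hp.1

theorem geom_sum_two_rpow_neg_le {ε : ℝ} (hε : 0 < ε) (hε1 : ε ≤ 1) (J : ℕ) :
    ∑ j ∈ Finset.range J, ((2 : ℝ) ^ (-ε)) ^ j ≤ 2 / (ε * Real.log 2) := by
  have h2 : 0 < Real.log 2 := Real.log_pos (by norm_num)
  have h2' : Real.log 2 ≤ 1 := by linarith [Real.log_two_lt_d9]
  have hlt : (2 : ℝ) ^ (-ε) < 1 := Real.rpow_lt_one_of_one_lt_of_neg (by norm_num) (by linarith)
  have hpos : (0 : ℝ) < 2 ^ (-ε) := by positivity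
  have hsum : ∑ j ∈ Finset.range J, ((2 : ℝ) ^ (-ε)) ^ j ≤ (1 - (2 : ℝ) ^ (-ε))⁻¹ := by
    rw [← tsum_geometric_of_lt_one hpos.le hlt]
    exact (summable_geometric_of_lt_one hpos.le hlt).sum_le_tsum _ fun _ _ ↦ by positivity
  refine hsum.trans ?_
  have hx : 0 < ε * Real.log 2 := by positivity
  have hx1 : ε * Real.log 2 ≤ 1 := by nlinarith
  have hb : 1 + ε * Real.log 2 ≤ (2 : ℝ) ^ ε := by
    rw [Real.rpow_def_of_pos (by norm_num), mul_comm (Real.log 2)]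
    linarith [Real.add_one_le_exp (ε * Real.log 2)]
  have hinv : (2 : ℝ) ^ (-ε) ≤ 1 - ε * Real.log 2 / 2 := by
    rw [Real.rpow_neg (by norm_num)]
    refine inv_le_of_inv_le₀ (by linarith) ((inv_le_of_inv_le₀ (by linarith) ?_))
    rw [inv_eq_one_div, div_le_iff₀ (by positivity)]
    nlinarith
  rw [inv_eq_one_div, div_le_div_iff₀ (by linarith) hx]
  linarith

/-- Partial sums over primes up to `N` of a bounded function divided by `p` are bounded above by
the corresponding Dirichlet series at `1 + ε`, up to an error that stays bounded when
`ε` is comparable to `1 / log N`. -/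
theorem exists_sum_div_le_tsum_rpow :
    ∃ C : ℝ, 0 < C ∧ ∀ (b : ℕ → ℝ) (d : ℝ), (∀ n, ¬ n.Prime → b n = 0) → (∀ n, |b n| ≤ d) →
      ∀ N : ℕ, 2 ≤ N → ∀ ε : ℝ, 0 < ε → ε ≤ 1 →
        ∑ p ∈ Nat.primesLE N, b p / p ≤ ∑' n, b n * (n : ℝ) ^ (-(1 + ε))
          + d * C * (ε * Real.log N + 1 / (ε * Real.log N)) := by
  obtain ⟨C₁, hC₁, H₁⟩ := exists_sum_primesLE_log_div_le
  have h4 : 0 < Real.log 4 := Real.log_pos (by norm_num)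
  have h2 : 0 < Real.log 2 := Real.log_pos (by norm_num)
  set C₂ := 2 * Real.log 4 * (2 / Real.log 2) with hC₂
  have hC₂pos : 0 < C₂ := by positivity
  refine ⟨C₁ + C₂, by positivity, fun b d hb hd N hN ε hε hε1 ↦ ?_⟩
  have hd0 : 0 ≤ d := (abs_nonneg _).trans (hd 0)
  have hlogN : 0 < Real.log N := Real.log_pos (by exact_mod_cast (by omega : 1 < N))
  have hsummable : Summable fun n : ℕ ↦ b n * (n : ℝ) ^ (-(1 + ε)) := by
    refine Summable.of_norm_bounded (g := fun n : ℕ ↦ d * (n : ℝ) ^ (-(1 + ε)))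
      ((Real.summable_nat_rpow.mpr (by linarith)).mul_left d) fun n ↦ ?_
    rw [norm_mul, Real.norm_eq_abs, Real.norm_eq_abs,
      abs_of_nonneg (Real.rpow_nonneg (Nat.cast_nonneg n) _)]
    gcongr
    exact hd n
  have hlim := hsummable.hasSum.tendsto_sum_nat
  have htends : Filter.Tendsto (fun J : ℕ ↦ 2 ^ J * N + 1) Filter.atTop Filter.atTop := by
    refine Filter.tendsto_atTop_mono (fun J ↦ ?_) Filter.tendsto_id
    have := Nat.lt_two_pow_self (n := J)
    simp only [id]
    nlinarith
  have hlim' := hlim.comp htends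
  rw [← sub_le_iff_le_add]
  refine ge_of_tendsto' hlim' fun J ↦ ?_
  simp only [Function.comp]
  have hrange : ∑ n ∈ Finset.range (2 ^ J * N + 1), b n * (n : ℝ) ^ (-(1 + ε)) =
      ∑ p ∈ Nat.primesLE (2 ^ J * N), b p * (p : ℝ) ^ (-(1 + ε)) := by
    symm
    refine Finset.sum_subset (fun p hp ↦ ?_) fun p hp hp' ↦ ?_
    · rw [Nat.mem_primesLE] at hp
      exact Finset.mem_range.mpr (by omega)
    · rw [Nat.mem_primesLE] at hp'
      rw [hb p fun h ↦ hp' ⟨by have := Finset.mem_range.mp hp; omega, h⟩, zero_mul]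
  have hsub : Nat.primesLE N ⊆ Nat.primesLE (2 ^ J * N) := fun p hp ↦ by
    rw [Nat.mem_primesLE] at hp ⊢
    exact ⟨hp.1.trans (Nat.le_mul_of_pos_left _ (by positivity)), hp.2⟩
  rw [hrange, ← Finset.sum_sdiff hsub]
  have htail : -(d * (C₂ * (1 / (ε * Real.log N)))) ≤
      ∑ p ∈ Nat.primesLE (2 ^ J * N) \ Nat.primesLE N, b p * (p : ℝ) ^ (-(1 + ε)) := by
    have h1 : ∑ p ∈ Nat.primesLE (2 ^ J * N) \ Nat.primesLE N, -(d * (p : ℝ) ^ (-(1 + ε))) ≤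
        ∑ p ∈ Nat.primesLE (2 ^ J * N) \ Nat.primesLE N, b p * (p : ℝ) ^ (-(1 + ε)) := by
      refine Finset.sum_le_sum fun p _ ↦ ?_
      rw [← neg_mul]
      gcongr
      exact (abs_le.mp (hd p)).1
    refine le_trans ?_ h1
    rw [Finset.sum_neg_distrib, ← Finset.mul_sum, neg_le_neg_iff]
    gcongr
    refine (sum_primesLE_sdiff_rpow_le hN hε J).trans ?_
    calc _ ≤ 2 * Real.log 4 / Real.log N * (2 / (ε * Real.log 2)) := by
          gcongr
          exact geom_sum_two_rpow_neg_le hε hε1 J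
      _ = _ := by rw [hC₂]; field_simp
  have hhead : ∑ p ∈ Nat.primesLE N, b p / p ≤
      ∑ p ∈ Nat.primesLE N, b p * (p : ℝ) ^ (-(1 + ε)) + d * (C₁ * (ε * Real.log N)) := by
    rw [← sub_le_iff_le_add', ← Finset.sum_sub_distrib]
    calc _ ≤ ∑ p ∈ Nat.primesLE N, d * ε * (Real.log p / p) := by
          refine Finset.sum_le_sum fun p hp ↦ ?_
          have hp0 : (0 : ℝ) < p := by exact_mod_cast (Nat.mem_primesLE.mp hp).2.pos
          have hp1 : (1 : ℝ) ≤ p := by exact_mod_cast (Nat.mem_primesLE.mp hp).2.one_le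
          have hfac : b p / p - b p * (p : ℝ) ^ (-(1 + ε)) = b p * ((1 - (p : ℝ) ^ (-ε)) / p) := by
            rw [neg_add, Real.rpow_add hp0, Real.rpow_neg_one]
            field_simp
          have hle1 : (p : ℝ) ^ (-ε) ≤ 1 := Real.rpow_le_one_of_one_le_of_nonpos hp1 (by linarith)
          have hge : 1 - (p : ℝ) ^ (-ε) ≤ ε * Real.log p := by
            rw [Real.rpow_def_of_pos hp0]
            linarith [Real.add_one_le_exp (Real.log p * -ε)]
          rw [hfac]
          calc _ ≤ d * ((1 - (p : ℝ) ^ (-ε)) / p) :=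
                mul_le_mul_of_nonneg_right (abs_le.mp (hd p)).2
                  (div_nonneg (by linarith) hp0.le)
            _ ≤ d * (ε * Real.log p / p) := by gcongr
            _ = _ := by ring
      _ ≤ d * ε * (C₁ * Real.log N) := by
          rw [← Finset.mul_sum]
          gcongr
          exact H₁ N hN
      _ = _ := by ring
  have h5 : 0 ≤ d * (C₁ * (1 / (ε * Real.log N))) := by positivity
  have h6 : 0 ≤ d * (C₂ * (ε * Real.log N)) := by positivity
  have : d * (C₁ + C₂) * (ε * Real.log N + 1 / (ε * Real.log N)) =
    d * (C₁ * (ε * Real.log N)) + d * (C₂ * (1 / (ε * Real.log N))) +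
    d * (C₁ * (1 / (ε * Real.log N))) + d * (C₂ * (ε * Real.log N)) := by ring
  linarith

section NumberFields

open NumberField Ideal

/-- The number of ideals of norm `n` in the ring of integers of `K`. -/
noncomputable def idealCount (K : Type*) [Field K] [NumberField K] (n : ℕ) : ℕ :=
  Nat.card {I : Ideal (𝓞 K) // absNorm I = n}

section Ideals

variable {K : Type*} [Field K] [NumberField K]

theorem absNorm_ne_zero {I : Ideal (𝓞 K)} (hI : I ≠ 0) : absNorm I ≠ 0 := by
  rwa [Ne, Ideal.absNorm_eq_zero_iff]

theorem two_le_absNorm_of_prime {P : Ideal (𝓞 K)} (hP : Prime P) : 2 ≤ absNorm P := by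
  have h0 := absNorm_ne_zero hP.ne_zero
  have h1 : absNorm P ≠ 1 := fun h ↦ hP.not_isUnit (Ideal.isUnit_iff.mpr (absNorm_eq_one_iff.mp h))
  omega

theorem card_primes_containing_le {p : ℕ} (hp : p.Prime) (S : Finset (Ideal (𝓞 K)))
    (hS : ∀ P ∈ S, Prime P ∧ (p : 𝓞 K) ∈ P) : S.card ≤ Module.finrank ℤ (𝓞 K) := by
  have hdvd : ∏ P ∈ S, P ∣ Ideal.span {(p : 𝓞 K)} :=
    Finset.prod_primes_dvd _ (fun P hP ↦ (hS P hP).1) fun P hP ↦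
      Ideal.dvd_span_singleton.mpr (hS P hP).2
  have h := absNorm_dvd_absNorm_of_le (Ideal.le_of_dvd hdvd)
  rw [absNorm_span_natCast, map_prod] at h
  have hpow : p ^ S.card ∣ ∏ P ∈ S, absNorm P := by
    rw [← Finset.prod_const]
    refine Finset.prod_dvd_prod_of_dvd _ _ fun P hP ↦ ?_
    have h1 : absNorm P ∣ p ^ Module.finrank ℤ (𝓞 K) := by
      rw [← absNorm_span_natCast]
      exact absNorm_dvd_absNorm_of_le ((Ideal.span_singleton_le_iff_mem _).mpr (hS P hP).2)
    obtain ⟨k, -, hk⟩ := (Nat.dvd_prime_pow hp).mp h1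
    have hk0 : k ≠ 0 := by
      rintro rfl
      have := two_le_absNorm_of_prime (hS P hP).1
      rw [hk, pow_zero] at this
      omega
    rw [hk]
    exact dvd_pow_self p hk0
  exact (Nat.pow_dvd_pow_iff_le_right hp.one_lt).mp (hpow.trans h)

theorem finite_absNorm_eq (n : ℕ) : {I : Ideal (𝓞 K) | absNorm I = n}.Finite :=
  finite_setOfPred_absNorm_eq n

theorem idealCount_eq_card (n : ℕ) :
    idealCount K n = (finite_absNorm_eq (K := K) n).toFinset.card :=
  Nat.card_eq_card_finite_toFinset _

theorem card_le_idealCount {n : ℕ} (S : Finset (Ideal (𝓞 K))) (hS : ∀ I ∈ S, absNorm I = n) :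
    S.card ≤ idealCount K n := by
  rw [idealCount_eq_card]
  exact Finset.card_le_card fun I hI ↦ by simpa using hS I hI

theorem prime_of_prime_absNorm {P : Ideal (𝓞 K)} (hP : (absNorm P).Prime) : Prime P := by
  refine Ideal.prime_of_isPrime ?_ (isPrime_of_irreducible_absNorm hP)
  rintro rfl
  simp [Nat.not_prime_zero] at hP

theorem idealCount_prime_le {p : ℕ} (hp : p.Prime) :
    idealCount K p ≤ Module.finrank ℤ (𝓞 K) := by
  rw [idealCount_eq_card]
  refine card_primes_containing_le hp _ fun P hP ↦ ?_
  have hP : absNorm P = p := by simpa using hP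
  exact ⟨prime_of_prime_absNorm (hP ▸ hp), hP ▸ absNorm_mem P⟩

theorem exists_prime_below {P : Ideal (𝓞 K)} (hP : Prime P) :
    ∃ p : ℕ, p.Prime ∧ (p : 𝓞 K) ∈ P ∧ (absNorm P ≠ p → p ^ 2 ≤ absNorm P) ∧ p ≤ absNorm P := by
  have : P.IsMaximal := (Ideal.isPrime_of_prime hP).isMaximal hP.ne_zero
  obtain ⟨p, n, hn, hmem, hp, h⟩ := exists_prime_and_absNorm_eq_pow P
  refine ⟨p, hp, hmem, fun hne ↦ ?_, ?_⟩
  · rw [h] at hne ⊢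
    refine Nat.pow_le_pow_right hp.pos ?_
    by_contra hlt
    exact hne (by rw [show n = 1 by omega, pow_one])
  · rw [h]
    exact Nat.le_self_pow hn.ne' p

end Ideals

section Sums

variable {K : Type*} [Field K] [NumberField K]

theorem sum_absNorm_rpow_eq_prod (S : Finset (Ideal (𝓞 K))) (s : ℝ) :
    ((absNorm (∏ P ∈ S, P) : ℕ) : ℝ) ^ s = ∏ P ∈ S, (absNorm P : ℝ) ^ s := by
  rw [map_prod, Nat.cast_prod, Real.finsetProd_rpow _ _ fun _ _ ↦ by positivity]

theorem summable_inv_sq : Summable fun n : ℕ ↦ 1 / (n : ℝ) ^ 2 :=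
  Real.summable_one_div_nat_pow.mpr (by norm_num)

theorem sum_prime_ideals_le_of_le_inv_sq (S : Finset (Ideal (𝓞 K))) (f : Ideal (𝓞 K) → ℝ)
    (hf : ∀ P ∈ S, ∃ p : ℕ, p.Prime ∧ (p : 𝓞 K) ∈ P ∧ f P ≤ 1 / (p : ℝ) ^ 2)
    (hS : ∀ P ∈ S, Prime P) :
    ∑ P ∈ S, f P ≤ Module.finrank ℤ (𝓞 K) * ∑' n : ℕ, 1 / (n : ℝ) ^ 2 := by
  classical
  choose! π hπ using hf
  calc ∑ P ∈ S, f P ≤ ∑ P ∈ S, 1 / (π P : ℝ) ^ 2 := Finset.sum_le_sum fun P hP ↦ (hπ P hP).2.2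
    _ = ∑ p ∈ S.image π, ∑ P ∈ S with π P = p, 1 / (π P : ℝ) ^ 2 :=
        (Finset.sum_fiberwise_of_maps_to (fun P hP ↦ Finset.mem_image_of_mem π hP) _).symm
    _ ≤ ∑ p ∈ S.image π, Module.finrank ℤ (𝓞 K) * (1 / (p : ℝ) ^ 2) := by
        refine Finset.sum_le_sum fun p hp ↦ ?_
        obtain ⟨Q, hQ, rfl⟩ := Finset.mem_image.mp hp
        have hc : ∀ P ∈ S.filter (π · = π Q),
            1 / (π P : ℝ) ^ 2 = 1 / (π Q : ℝ) ^ 2 := fun P hP ↦ by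
          rw [(Finset.mem_filter.mp hP).2]
        rw [Finset.sum_congr rfl hc, Finset.sum_const, nsmul_eq_mul]
        gcongr
        refine card_primes_containing_le (hπ Q hQ).1 _ fun P hP ↦ ?_
        obtain ⟨hPS, hPQ⟩ := Finset.mem_filter.mp hP
        exact ⟨hS P hPS, hPQ ▸ (hπ P hPS).2.1⟩
    _ ≤ _ := by
        rw [← Finset.mul_sum]
        gcongr
        exact summable_inv_sq.sum_le_tsum _ fun _ _ ↦ by positivity

/-- The coefficients of the sum over primes of degree one. -/
noncomputable def primeCoeff (K : Type*) [Field K] [NumberField K] (n : ℕ) : ℝ :=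
  open Classical in if n.Prime then idealCount K n else 0

theorem primeCoeff_nonneg (n : ℕ) : 0 ≤ primeCoeff K n := by
  unfold primeCoeff; split_ifs <;> simp

theorem primeCoeff_le (n : ℕ) : primeCoeff K n ≤ Module.finrank ℤ (𝓞 K) := by
  unfold primeCoeff
  split_ifs with h
  · exact_mod_cast idealCount_prime_le h
  · positivity

theorem summable_primeCoeff {s : ℝ} (hs : 1 < s) :
    Summable fun n : ℕ ↦ primeCoeff K n * (n : ℝ) ^ (-s) :=
  Summable.of_nonneg_of_le (fun n ↦ mul_nonneg (primeCoeff_nonneg n) (by positivity))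
    (fun n ↦ mul_le_mul_of_nonneg_right (primeCoeff_le n) (by positivity))
    ((Real.summable_nat_rpow.mpr (by linarith)).mul_left _)

theorem rpow_neg_le_inv {n : ℕ} (hn : 0 < n) {s : ℝ} (hs : 1 ≤ s) :
    (n : ℝ) ^ (-s) ≤ 1 / n := by
  rw [one_div, ← Real.rpow_neg_one]
  exact Real.rpow_le_rpow_of_exponent_le (by exact_mod_cast hn) (by linarith)

theorem sum_sq_absNorm_rpow_le {s : ℝ} (hs : 1 ≤ s) (S : Finset (Ideal (𝓞 K)))
    (hS : ∀ P ∈ S, Prime P) :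
    ∑ P ∈ S, ((absNorm P : ℝ) ^ (-s)) ^ 2 ≤
      Module.finrank ℤ (𝓞 K) * ∑' n : ℕ, 1 / (n : ℝ) ^ 2 := by
  refine sum_prime_ideals_le_of_le_inv_sq S _ (fun P hP ↦ ?_) hS
  obtain ⟨p, hp, hmem, -, hle⟩ := exists_prime_below (hS P hP)
  refine ⟨p, hp, hmem, ?_⟩
  have hp0 : (0 : ℝ) < p := by exact_mod_cast hp.pos
  have := two_le_absNorm_of_prime (hS P hP)
  calc ((absNorm P : ℝ) ^ (-s)) ^ 2 ≤ (1 / (absNorm P : ℝ)) ^ 2 := by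
        gcongr
        exact rpow_neg_le_inv (by omega) hs
    _ ≤ (1 / (p : ℝ)) ^ 2 := by gcongr
    _ = _ := by rw [div_pow, one_pow]

theorem sum_absNorm_rpow_le {s : ℝ} (hs : 1 < s) (S : Finset (Ideal (𝓞 K)))
    (hS : ∀ P ∈ S, Prime P) :
    ∑ P ∈ S, (absNorm P : ℝ) ^ (-s) ≤ ∑' n : ℕ, primeCoeff K n * (n : ℝ) ^ (-s) +
      Module.finrank ℤ (𝓞 K) * ∑' n : ℕ, 1 / (n : ℝ) ^ 2 := by
  classical
  rw [← Finset.sum_filter_add_sum_filter_not S (fun P ↦ (absNorm P).Prime)]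
  gcongr ?_ + ?_
  · set T := S.filter fun P ↦ (absNorm P).Prime
    calc ∑ P ∈ T, (absNorm P : ℝ) ^ (-s)
        = ∑ n ∈ T.image absNorm, ∑ P ∈ T with absNorm P = n, (absNorm P : ℝ) ^ (-s) :=
          (Finset.sum_fiberwise_of_maps_to (fun P hP ↦ Finset.mem_image_of_mem _ hP) _).symm
      _ ≤ ∑ n ∈ T.image absNorm, primeCoeff K n * (n : ℝ) ^ (-s) := by
          refine Finset.sum_le_sum fun n hn ↦ ?_
          obtain ⟨Q, hQ, rfl⟩ := Finset.mem_image.mp hn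
          have hc : ∀ P ∈ T.filter (absNorm · = absNorm Q),
              (absNorm P : ℝ) ^ (-s) = (absNorm Q : ℝ) ^ (-s) := fun P hP ↦ by
            rw [(Finset.mem_filter.mp hP).2]
          rw [Finset.sum_congr rfl hc, Finset.sum_const, nsmul_eq_mul]
          gcongr
          rw [primeCoeff, if_pos (Finset.mem_filter.mp hQ).2]
          exact_mod_cast card_le_idealCount _ fun P hP ↦ (Finset.mem_filter.mp hP).2
      _ ≤ _ := (summable_primeCoeff hs).sum_le_tsum _ fun n _ ↦
          mul_nonneg (primeCoeff_nonneg n) (by positivity)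
  · refine sum_prime_ideals_le_of_le_inv_sq _ _ (fun P hP ↦ ?_) fun P hP ↦
      hS P (Finset.mem_filter.mp hP).1
    obtain ⟨hPS, hPn⟩ := Finset.mem_filter.mp hP
    obtain ⟨p, hp, hmem, hsq, -⟩ := exists_prime_below (hS P hPS)
    refine ⟨p, hp, hmem, ?_⟩
    have hp0 : (0 : ℝ) < p := by exact_mod_cast hp.pos
    have h2 := two_le_absNorm_of_prime (hS P hPS)
    refine (rpow_neg_le_inv (by omega) hs.le).trans ?_
    gcongr
    exact_mod_cast hsq fun h ↦ hPn (h ▸ hp)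

end Sums

section Zeta

variable {K : Type*} [Field K] [NumberField K]

theorem sum_absNorm_rpow_le_tsum {s : ℝ}
    (hsum : Summable fun n : ℕ ↦ (idealCount K n : ℝ) * (n : ℝ) ^ (-s))
    (G : Finset (Ideal (𝓞 K))) :
    ∑ I ∈ G, (absNorm I : ℝ) ^ (-s) ≤ ∑' n : ℕ, (idealCount K n : ℝ) * (n : ℝ) ^ (-s) := by
  classical
  calc ∑ I ∈ G, (absNorm I : ℝ) ^ (-s)
      = ∑ n ∈ G.image absNorm, ∑ I ∈ G with absNorm I = n, (absNorm I : ℝ) ^ (-s) :=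
        (Finset.sum_fiberwise_of_maps_to (fun I hI ↦ Finset.mem_image_of_mem _ hI) _).symm
    _ ≤ ∑ n ∈ G.image absNorm, (idealCount K n : ℝ) * (n : ℝ) ^ (-s) := by
        refine Finset.sum_le_sum fun n _ ↦ ?_
        have hc : ∀ I ∈ G.filter (absNorm · = n),
            (absNorm I : ℝ) ^ (-s) = (n : ℝ) ^ (-s) := fun I hI ↦ by
          rw [(Finset.mem_filter.mp hI).2]
        rw [Finset.sum_congr rfl hc, Finset.sum_const, nsmul_eq_mul]
        gcongr
        exact card_le_idealCount _ fun I hI ↦ (Finset.mem_filter.mp hI).2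
    _ ≤ _ := hsum.sum_le_tsum _ fun n _ ↦ by positivity

theorem tsum_idealCount_le {s B : ℝ} (hs : 1 < s)
    (hB : ∀ G : Finset (Ideal (𝓞 K)), (∀ I ∈ G, I ≠ 0) → ∑ I ∈ G, (absNorm I : ℝ) ^ (-s) ≤ B) :
    ∑' n : ℕ, (idealCount K n : ℝ) * (n : ℝ) ^ (-s) ≤ B := by
  classical
  refine Real.tsum_le_of_sum_le (fun n ↦ by positivity) fun T ↦ ?_
  set fib : ℕ → Finset (Ideal (𝓞 K)) := fun n ↦ (finite_absNorm_eq (K := K) n).toFinset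
  have hfib : ∀ n I, I ∈ fib n ↔ absNorm I = n := fun n I ↦ by simp [fib]
  have hzero : (idealCount K 0 : ℝ) * ((0 : ℕ) : ℝ) ^ (-s) = 0 := by
    rw [Nat.cast_zero, Real.zero_rpow (by linarith), mul_zero]
  calc ∑ n ∈ T, (idealCount K n : ℝ) * (n : ℝ) ^ (-s)
      = ∑ n ∈ T.erase 0, (idealCount K n : ℝ) * (n : ℝ) ^ (-s) :=
        (Finset.sum_erase T hzero).symm
    _ = ∑ n ∈ T.erase 0, ∑ I ∈ fib n, (absNorm I : ℝ) ^ (-s) := by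
        refine Finset.sum_congr rfl fun n _ ↦ ?_
        rw [Finset.sum_congr rfl fun I hI ↦ by rw [(hfib n I).mp hI], Finset.sum_const,
          nsmul_eq_mul, idealCount_eq_card]
    _ = ∑ I ∈ (T.erase 0).biUnion fib, (absNorm I : ℝ) ^ (-s) := by
        rw [Finset.sum_biUnion]
        intro m _ n _ hmn
        rw [Function.onFun, Finset.disjoint_left]
        intro I hI hI'
        exact hmn (((hfib m I).mp hI).symm.trans ((hfib n I).mp hI'))
    _ ≤ B := by
        refine hB _ fun I hI ↦ ?_
        obtain ⟨n, hn, hI⟩ := Finset.mem_biUnion.mp hI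
        rintro rfl
        have h0 : n = 0 := ((hfib n 0).mp hI).symm.trans (by simp)
        exact (Finset.ne_of_mem_erase hn) h0

theorem injOn_finset_prod_primes (S : Finset (Ideal (𝓞 K))) (hS : ∀ P ∈ S, Prime P) :
    Set.InjOn (fun T : Finset (Ideal (𝓞 K)) ↦ ∏ P ∈ T, P) (S.powerset : Set (Finset _)) := by
  have key : ∀ T ∈ S.powerset,
      UniqueFactorizationMonoid.normalizedFactors (∏ P ∈ T, P) = T.val := fun T hT ↦ by
    rw [Finset.prod_eq_multiset_prod, Multiset.map_id']
    exact UniqueFactorizationMonoid.normalizedFactors_prod_of_prime fun P hP ↦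
      hS P (Finset.mem_powerset.mp hT hP)
  intro T hT T' hT' h
  have h' : ∏ P ∈ T, P = ∏ P ∈ T', P := h
  rw [← Finset.val_inj, ← key T hT, ← key T' hT', h']

theorem exp_sub_sq_le_one_add {x : ℝ} (hx0 : 0 ≤ x) :
    Real.exp (x - x ^ 2) ≤ 1 + x := by
  have h := Real.add_one_le_exp (-(x - x ^ 2))
  have hpos : 0 < 1 - (x - x ^ 2) := by nlinarith
  have h2 : Real.exp (x - x ^ 2) * Real.exp (-(x - x ^ 2)) = 1 := by
    rw [← Real.exp_add, add_neg_cancel, Real.exp_zero]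
  have h3 : 1 ≤ (1 + x) * (1 - (x - x ^ 2)) := by nlinarith [pow_nonneg hx0 3]
  have h4 : (1 + x) * (1 - (x - x ^ 2)) ≤ (1 + x) * Real.exp (-(x - x ^ 2)) :=
    mul_le_mul_of_nonneg_left (by linarith) (by linarith)
  exact le_of_mul_le_mul_right (h2.le.trans (h3.trans h4)) (Real.exp_pos _)

theorem inv_one_sub_le_exp_add_sq {x : ℝ} (hx0 : 0 ≤ x) (hx1 : x ≤ 1 / 2) :
    (1 - x)⁻¹ ≤ Real.exp (x + x ^ 2) := by
  rw [inv_le_iff_one_le_mul₀ (by linarith)]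
  have h := Real.quadratic_le_exp_of_nonneg (x := x + x ^ 2) (by positivity)
  have h2 : 1 ≤ (1 + (x + x ^ 2) + (x + x ^ 2) ^ 2 / 2) * (1 - x) := by
    nlinarith [pow_nonneg hx0 2, pow_nonneg hx0 3, pow_nonneg hx0 4,
      mul_nonneg (pow_nonneg hx0 2) (by linarith : 0 ≤ 1 / 2 - x),
      mul_nonneg (pow_nonneg hx0 3) (by linarith : 0 ≤ 1 / 2 - x),
      mul_nonneg (pow_nonneg hx0 4) (by linarith : 0 ≤ 1 / 2 - x)]
  exact h2.trans (mul_le_mul_of_nonneg_right h (by linarith))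

theorem absNorm_rpow_neg_le_half {s : ℝ} (hs : 1 ≤ s) {P : Ideal (𝓞 K)} (hP : Prime P) :
    (absNorm P : ℝ) ^ (-s) ≤ 1 / 2 := by
  have h := two_le_absNorm_of_prime hP
  refine (rpow_neg_le_inv (by omega) hs).trans ?_
  gcongr
  exact_mod_cast h

theorem exp_sum_le_tsum_idealCount {s : ℝ} (hs : 1 < s)
    (hsum : Summable fun n : ℕ ↦ (idealCount K n : ℝ) * (n : ℝ) ^ (-s))
    (S : Finset (Ideal (𝓞 K))) (hS : ∀ P ∈ S, Prime P) :
    Real.exp (∑ P ∈ S, (absNorm P : ℝ) ^ (-s) -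
        Module.finrank ℤ (𝓞 K) * ∑' n : ℕ, 1 / (n : ℝ) ^ 2) ≤
      ∑' n : ℕ, (idealCount K n : ℝ) * (n : ℝ) ^ (-s) := by
  classical
  calc _ ≤ Real.exp (∑ P ∈ S, ((absNorm P : ℝ) ^ (-s) - ((absNorm P : ℝ) ^ (-s)) ^ 2)) := by
        rw [Finset.sum_sub_distrib]
        gcongr
        exact sum_sq_absNorm_rpow_le hs.le S hS
    _ = ∏ P ∈ S, Real.exp ((absNorm P : ℝ) ^ (-s) - ((absNorm P : ℝ) ^ (-s)) ^ 2) :=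
        Real.exp_sum _ _
    _ ≤ ∏ P ∈ S, (1 + (absNorm P : ℝ) ^ (-s)) := by
        refine Finset.prod_le_prod (fun _ _ ↦ (Real.exp_pos _).le) fun P _ ↦ ?_
        exact exp_sub_sq_le_one_add (by positivity)
    _ = ∑ T ∈ S.powerset, (absNorm (∏ P ∈ T, P) : ℝ) ^ (-s) := by
        rw [Finset.prod_one_add]
        exact Finset.sum_congr rfl fun T _ ↦ (sum_absNorm_rpow_eq_prod T (-s)).symm
    _ = ∑ I ∈ S.powerset.image (fun T ↦ ∏ P ∈ T, P), (absNorm I : ℝ) ^ (-s) :=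
        (Finset.sum_image (f := fun I : Ideal (𝓞 K) ↦ (absNorm I : ℝ) ^ (-s))
          (injOn_finset_prod_primes S hS)).symm
    _ ≤ _ := sum_absNorm_rpow_le_tsum hsum _

theorem sum_absNorm_rpow_le_prod {s : ℝ} (hs : 1 < s) (G : Finset (Ideal (𝓞 K)))
    (hG : ∀ I ∈ G, I ≠ 0) :
    ∃ S : Finset (Ideal (𝓞 K)), (∀ P ∈ S, Prime P) ∧
      ∑ I ∈ G, (absNorm I : ℝ) ^ (-s) ≤ ∏ P ∈ S, (1 - (absNorm P : ℝ) ^ (-s))⁻¹ := by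
  classical
  set nf := fun I : Ideal (𝓞 K) ↦ UniqueFactorizationMonoid.normalizedFactors I
  set S := G.biUnion fun I ↦ (nf I).toFinset
  have hS : ∀ P ∈ S, Prime P := fun P hP ↦ by
    obtain ⟨I, -, hI⟩ := Finset.mem_biUnion.mp hP
    exact UniqueFactorizationMonoid.prime_of_normalized_factor P (Multiset.mem_toFinset.mp hI)
  set E := G.sup (fun I ↦ (nf I).card) + 1
  have hfac : ∀ I ∈ G, ∏ P ∈ S.attach, (P : Ideal (𝓞 K)) ^ (nf I).count (P : Ideal (𝓞 K)) = I := by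
    intro I hI
    rw [Finset.prod_attach S (fun P ↦ P ^ (nf I).count P),
      ← Finset.prod_multiset_count_of_subset (nf I) S
      (fun P hP ↦ Finset.mem_biUnion.mpr ⟨I, hI, hP⟩)]
    exact Ideal.prod_normalizedFactors_eq_self (hG I hI)
  refine ⟨S, hS, ?_⟩
  set e : Ideal (𝓞 K) → (P : Ideal (𝓞 K)) → P ∈ S → ℕ := fun I P _ ↦ (nf I).count P
  have hinj : Set.InjOn e (G : Set (Ideal (𝓞 K))) := by
    intro I hI J hJ h
    rw [← hfac I hI, ← hfac J hJ]
    refine Finset.prod_congr rfl fun P _ ↦ ?_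
    exact congrArg _ (congrFun (congrFun h P.1) P.2)
  calc ∑ I ∈ G, (absNorm I : ℝ) ^ (-s)
      = ∑ I ∈ G, ∏ P ∈ S.attach, ((absNorm P.1 : ℝ) ^ (-s)) ^ (e I P.1 P.2) := by
        refine Finset.sum_congr rfl fun I hI ↦ ?_
        conv_lhs => rw [← hfac I hI]
        rw [map_prod, Nat.cast_prod, ← Real.finsetProd_rpow _ _ fun _ _ ↦ by positivity]
        refine Finset.prod_congr rfl fun P _ ↦ ?_
        rw [map_pow, Nat.cast_pow, ← Real.rpow_natCast_mul (by positivity), mul_comm,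
          Real.rpow_mul_natCast (by positivity)]
    _ = ∑ f ∈ G.image e, ∏ P ∈ S.attach, ((absNorm P.1 : ℝ) ^ (-s)) ^ (f P.1 P.2) :=
        (Finset.sum_image (f := fun f : (P : Ideal (𝓞 K)) → P ∈ S → ℕ ↦
          ∏ P ∈ S.attach, ((absNorm P.1 : ℝ) ^ (-s)) ^ (f P.1 P.2)) hinj).symm
    _ ≤ ∑ f ∈ S.pi fun _ ↦ Finset.range E,
          ∏ P ∈ S.attach, ((absNorm P.1 : ℝ) ^ (-s)) ^ (f P.1 P.2) := by
        refine Finset.sum_le_sum_of_subset_of_nonneg (fun f hf ↦ ?_) fun f _ _ ↦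
          Finset.prod_nonneg fun P _ ↦ by positivity
        obtain ⟨I, hI, rfl⟩ := Finset.mem_image.mp hf
        refine Finset.mem_pi.mpr fun P _ ↦ Finset.mem_range.mpr (Nat.lt_succ_of_le ?_)
        exact (Multiset.count_le_card _ _).trans (Finset.le_sup (f := fun I ↦ (nf I).card) hI)
    _ = ∏ P ∈ S, ∑ j ∈ Finset.range E, ((absNorm P : ℝ) ^ (-s)) ^ j :=
        (Finset.prod_sum S (fun _ ↦ Finset.range E)
          (fun P j ↦ ((absNorm P : ℝ) ^ (-s)) ^ j)).symm
    _ ≤ _ := by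
        refine Finset.prod_le_prod (fun P _ ↦ Finset.sum_nonneg fun _ _ ↦ by positivity)
          fun P hP ↦ ?_
        have hx := absNorm_rpow_neg_le_half hs.le (hS P hP)
        rw [← tsum_geometric_of_lt_one (by positivity) (by linarith)]
        exact (summable_geometric_of_lt_one (by positivity) (by linarith)).sum_le_tsum _
          fun _ _ ↦ by positivity

theorem tsum_idealCount_le_exp {s : ℝ} (hs : 1 < s) :
    ∑' n : ℕ, (idealCount K n : ℝ) * (n : ℝ) ^ (-s) ≤
      Real.exp (∑' n : ℕ, primeCoeff K n * (n : ℝ) ^ (-s) +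
        2 * (Module.finrank ℤ (𝓞 K) * ∑' n : ℕ, 1 / (n : ℝ) ^ 2)) := by
  refine tsum_idealCount_le hs fun G hG ↦ ?_
  obtain ⟨S, hS, hle⟩ := sum_absNorm_rpow_le_prod hs G hG
  refine hle.trans ?_
  calc _ ≤ ∏ P ∈ S, Real.exp ((absNorm P : ℝ) ^ (-s) + ((absNorm P : ℝ) ^ (-s)) ^ 2) := by
        refine Finset.prod_le_prod (fun P hP ↦ ?_) fun P hP ↦ ?_
        · have := absNorm_rpow_neg_le_half hs.le (hS P hP)
          exact inv_nonneg.mpr (by linarith)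
        · exact inv_one_sub_le_exp_add_sq (by positivity) (absNorm_rpow_neg_le_half hs.le (hS P hP))
    _ ≤ _ := by
        rw [← Real.exp_sum, Finset.sum_add_distrib]
        refine Real.exp_le_exp.mpr ?_
        linarith [sum_absNorm_rpow_le hs S hS, sum_sq_absNorm_rpow_le hs.le S hS]

theorem exp_tsum_primeCoeff_le {s : ℝ} (hs : 1 < s)
    (hsum : Summable fun n : ℕ ↦ (idealCount K n : ℝ) * (n : ℝ) ^ (-s)) :
    Real.exp (∑' n : ℕ, primeCoeff K n * (n : ℝ) ^ (-s) -
        Module.finrank ℤ (𝓞 K) * ∑' n : ℕ, 1 / (n : ℝ) ^ 2) ≤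
      ∑' n : ℕ, (idealCount K n : ℝ) * (n : ℝ) ^ (-s) := by
  classical
  set Z := ∑' n : ℕ, (idealCount K n : ℝ) * (n : ℝ) ^ (-s)
  set D : ℝ := (Module.finrank ℤ (𝓞 K) : ℝ) * ∑' n : ℕ, 1 / (n : ℝ) ^ 2
  have hZ : 0 < Z := (Real.exp_pos _).trans_le
    (exp_sum_le_tsum_idealCount hs hsum ∅ (by simp))
  rw [← Real.le_log_iff_exp_le hZ, sub_le_iff_le_add]
  refine Real.tsum_le_of_sum_le (fun n ↦ mul_nonneg (primeCoeff_nonneg n) (by positivity))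
    fun T ↦ ?_
  set fib : ℕ → Finset (Ideal (𝓞 K)) := fun n ↦ (finite_absNorm_eq (K := K) n).toFinset
  have hfib : ∀ n I, I ∈ fib n ↔ absNorm I = n := fun n I ↦ by simp [fib]
  set S := (T.filter Nat.Prime).biUnion fib
  have hS : ∀ P ∈ S, Prime P := fun P hP ↦ by
    obtain ⟨n, hn, hP⟩ := Finset.mem_biUnion.mp hP
    exact prime_of_prime_absNorm ((hfib n P).mp hP ▸ (Finset.mem_filter.mp hn).2)
  have h := exp_sum_le_tsum_idealCount hs hsum S hS
  rw [← Real.le_log_iff_exp_le hZ, sub_le_iff_le_add] at h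
  refine le_trans (le_of_eq ?_) h
  rw [Finset.sum_biUnion, Finset.sum_filter]
  · refine Finset.sum_congr rfl fun n _ ↦ ?_
    unfold primeCoeff
    split_ifs with hn
    · rw [Finset.sum_congr rfl fun I hI ↦ by rw [(hfib n I).mp hI], Finset.sum_const,
        nsmul_eq_mul, idealCount_eq_card]
    · rw [zero_mul]
  · intro m _ n _ hmn
    rw [Function.onFun, Finset.disjoint_left]
    intro I hI hI'
    exact hmn (((hfib m I).mp hI).symm.trans ((hfib n I).mp hI'))

theorem dedekindZeta_eq_tsum {s : ℝ} (hs : 1 < s) :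
    dedekindZeta K s = ((∑' n : ℕ, (idealCount K n : ℝ) * (n : ℝ) ^ (-s) : ℝ) : ℂ) := by
  rw [dedekindZeta, LSeries, Complex.ofReal_tsum]
  refine tsum_congr fun n ↦ ?_
  rcases eq_or_ne n 0 with rfl | hn
  · rw [LSeries.term_zero, Nat.cast_zero, Real.zero_rpow (by linarith), mul_zero,
      Complex.ofReal_zero]
  · rw [LSeries.term_of_ne_zero hn, Complex.ofReal_mul, Complex.ofReal_cpow (by positivity),
      Complex.ofReal_neg, Complex.cpow_neg, div_eq_mul_inv]
    simp [idealCount]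

/-- The sum of `p ^ (-s)` over the prime ideals of degree one behaves like `log (1 / (s - 1))`
as `s` tends to `1` from the right. -/
theorem exists_abs_tsum_primeCoeff_add_log_le (K : Type*) [Field K] [NumberField K] :
    ∃ δ : ℝ, 0 < δ ∧ ∃ C : ℝ, ∀ s : ℝ, 1 < s → s < 1 + δ →
      |∑' n : ℕ, primeCoeff K n * (n : ℝ) ^ (-s) + Real.log (s - 1)| ≤ C := by
  set κ := dedekindZeta_residue K
  have hκ : 0 < κ := dedekindZeta_residue_pos K
  set Z : ℝ → ℝ := fun s ↦ ∑' n : ℕ, (idealCount K n : ℝ) * (n : ℝ) ^ (-s)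
  have hlim : Filter.Tendsto (fun s : ℝ ↦ (s - 1) * Z s) (nhdsWithin 1 (Set.Ioi 1)) (nhds κ) := by
    have h := (Complex.continuous_re.tendsto _).comp (tendsto_sub_one_mul_dedekindZeta_nhdsGT K)
    rw [Complex.ofReal_re] at h
    refine h.congr' ?_
    filter_upwards [self_mem_nhdsWithin] with s hs
    rw [Function.comp, dedekindZeta_eq_tsum hs, ← Complex.ofReal_one, ← Complex.ofReal_sub,
      ← Complex.ofReal_mul, Complex.ofReal_re]
  have hev : ∀ᶠ s in nhdsWithin 1 (Set.Ioi 1), (s - 1) * Z s ∈ Set.Ioo (κ / 2) (2 * κ) :=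
    hlim.eventually_mem (Ioo_mem_nhds (by linarith) (by linarith))
  obtain ⟨u, hu, hsub⟩ := (mem_nhdsGT_iff_exists_Ioo_subset).mp hev
  have hu1 : (1 : ℝ) < u := hu
  set D : ℝ := (Module.finrank ℤ (𝓞 K) : ℝ) * ∑' n : ℕ, 1 / (n : ℝ) ^ 2
  refine ⟨u - 1, by linarith, 2 * D + |Real.log (κ / 2)| + |Real.log (2 * κ)|,
    fun s hs hs' ↦ ?_⟩
  obtain ⟨hl, hr⟩ : κ / 2 < (s - 1) * Z s ∧ (s - 1) * Z s < 2 * κ :=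
    hsub ⟨hs, by linarith⟩
  have hs1 : 0 < s - 1 := by linarith
  have hZ : 0 < Z s := pos_of_mul_pos_right (by linarith : 0 < (s - 1) * Z s) hs1.le
  have hsum : Summable fun n : ℕ ↦ (idealCount K n : ℝ) * (n : ℝ) ^ (-s) := by
    by_contra h
    exact hZ.ne' (tsum_eq_zero_of_not_summable h)
  have hD : 0 ≤ D := mul_nonneg (by positivity) (tsum_nonneg fun _ ↦ by positivity)
  have hup := (Real.le_log_iff_exp_le hZ).mpr (exp_tsum_primeCoeff_le hs hsum)
  have hlo := (Real.log_le_iff_le_exp hZ).mpr (tsum_idealCount_le_exp (K := K) hs)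
  have hlog : Real.log ((s - 1) * Z s) = Real.log (s - 1) + Real.log (Z s) :=
    Real.log_mul hs1.ne' hZ.ne'
  have h1 := Real.log_le_log (by linarith) hl.le
  have h2 := Real.log_le_log (by linarith) hr.le
  rw [abs_le]
  constructor
  · linarith [neg_abs_le (Real.log (κ / 2)), abs_nonneg (Real.log (2 * κ))]
  · linarith [le_abs_self (Real.log (2 * κ)), abs_nonneg (Real.log (κ / 2))]

end Zeta

section Localization

/-- The elements of `F` lying in the image of `f` up to a power of `M`. -/
def awayRange {R F : Type*} [CommRing R] [CommRing F] (f : R →+* F) (M : ℤ) : Subring F where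
  carrier := {x | ∃ k : ℕ, ∃ r : R, (M : F) ^ k * x = f r}
  mul_mem' := by
    rintro x y ⟨k, r, h⟩ ⟨l, s, h'⟩
    exact ⟨k + l, r * s, by rw [map_mul, ← h, ← h']; ring⟩
  one_mem' := ⟨0, 1, by simp⟩
  add_mem' := by
    rintro x y ⟨k, r, h⟩ ⟨l, s, h'⟩
    refine ⟨k + l, M ^ l * r + M ^ k * s, ?_⟩
    rw [map_add, map_mul, map_mul, ← h, ← h', map_pow, map_pow, map_intCast]; ring
  zero_mem' := ⟨0, 0, by simp⟩
  neg_mem' := by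
    rintro x ⟨k, r, h⟩
    exact ⟨k, -r, by rw [map_neg, ← h]; ring⟩

theorem card_ringHom_eq_of_isLocalization {R T A : Type*} [CommRing R] [CommRing T] [CommRing A]
    [Algebra R T] {M : ℤ} [IsLocalization.Away (M : R) T] (hM : IsUnit (M : A)) :
    Nat.card (R →+* A) = Nat.card (T →+* A) := by
  have hu : ∀ φ : R →+* A, IsUnit (φ (M : R)) := fun φ ↦ by rwa [map_intCast]
  refine Nat.card_congr
    { toFun := fun φ ↦ IsLocalization.Away.lift (M : R) (hu φ)
      invFun := fun ψ ↦ ψ.comp (algebraMap R T)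
      left_inv := fun φ ↦ IsLocalization.Away.lift_comp (M : R) (hu φ)
      right_inv := fun ψ ↦ ?_ }
  exact IsLocalization.ringHom_ext (Submonoid.powers (M : R))
    (IsLocalization.Away.lift_comp (M : R) (hu (ψ.comp (algebraMap R T))))

theorem card_ringHom_awayRange {R F A : Type*} [CommRing R] [Field F] [CharZero F] [CommRing A]
    (f : R →+* F) {M : ℤ} (hM0 : M ≠ 0)
    (hker : ∀ r, f r = 0 → ∃ k : ℕ, (M : R) ^ k * r = 0) (hM : IsUnit (M : A)) :
    Nat.card (R →+* A) = Nat.card (awayRange f M →+* A) := by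
  have hMF : (M : F) ≠ 0 := Int.cast_ne_zero.mpr hM0
  let ι : R →+* awayRange f M := f.codRestrict (awayRange f M) fun r ↦ ⟨0, r, by simp⟩
  let _ : Algebra R (awayRange f M) := ι.toAlgebra
  have hι : ∀ r, ((algebraMap R (awayRange f M) r : awayRange f M) : F) = f r := fun _ ↦ rfl
  have : IsLocalization.Away (M : R) (awayRange f M) := by
    refine ⟨⟨?_, ?_, ?_⟩⟩
    · rintro ⟨-, k, rfl⟩
      rw [map_pow, map_intCast]
      refine IsUnit.pow k (IsUnit.of_mul_eq_one ⟨(M : F)⁻¹, 1, 1, ?_⟩ ?_)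
      · rw [pow_one, mul_inv_cancel₀ hMF, map_one]
      · exact Subtype.ext (by push_cast; exact mul_inv_cancel₀ hMF)
    · rintro ⟨x, k, r, h⟩
      refine ⟨⟨r, ⟨(M : R) ^ k, k, rfl⟩⟩, Subtype.ext ?_⟩
      rw [Subring.coe_mul, hι, hι, ← h, map_pow, map_intCast, mul_comm]
    · intro r s h
      have h : f r = f s := by rw [← hι, ← hι, h]
      obtain ⟨k, hk⟩ := hker (r - s) (by rw [map_sub, h, sub_self])
      exact ⟨⟨(M : R) ^ k, k, rfl⟩, by linear_combination hk⟩
  exact card_ringHom_eq_of_isLocalization hM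

theorem awayRange_le {R S F : Type*} [CommRing R] [CommRing S] [CommRing F]
    (f : R →+* F) (h : S →+* F) {M : ℤ} (hfh : ∀ r, f r ∈ awayRange h M) :
    awayRange f M ≤ awayRange h M := by
  rintro x ⟨k, r, hr⟩
  obtain ⟨l, s, hs⟩ := hfh r
  exact ⟨l + k, s, by rw [pow_add, mul_assoc, hr, hs]⟩

theorem card_ringHom_eq_card_ringHom {R S F A : Type*} [CommRing R] [CommRing S] [Field F]
    [CharZero F] [CommRing A] (f : R →+* F) (h : S →+* F) {M : ℤ} (hM0 : M ≠ 0)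
    (hf : ∀ r, f r = 0 → ∃ k : ℕ, (M : R) ^ k * r = 0)
    (hh : ∀ s, h s = 0 → ∃ k : ℕ, (M : S) ^ k * s = 0)
    (hfh : ∀ r, f r ∈ awayRange h M) (hhf : ∀ s, h s ∈ awayRange f M) (hM : IsUnit (M : A)) :
    Nat.card (R →+* A) = Nat.card (S →+* A) := by
  rw [card_ringHom_awayRange f hM0 hf hM, card_ringHom_awayRange h hM0 hh hM,
    le_antisymm (awayRange_le f h hfh) (awayRange_le h f hhf)]

end Localization

section RingOfIntegers

variable {F : Type*} [Field F] [NumberField F]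

theorem ker_injective_of_ringHom_zmod {R : Type*} [CommRing R] {n : ℕ} :
    Function.Injective (RingHom.ker : (R →+* ZMod n) → Ideal R) := by
  intro φ ψ h
  ext x
  obtain ⟨m, hm⟩ := ZMod.intCast_surjective (φ x)
  have hx : x - m ∈ RingHom.ker φ := by
    rw [RingHom.mem_ker, map_sub, map_intCast, hm, sub_self]
  rw [h, RingHom.mem_ker, map_sub, map_intCast, sub_eq_zero] at hx
  rw [hx, hm]

theorem idealCount_eq_card_ringHom {p : ℕ} (hp : p.Prime) :
    idealCount F p = Nat.card (𝓞 F →+* ZMod p) := by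
  have := Fact.mk hp
  symm
  have hnorm : ∀ φ : 𝓞 F →+* ZMod p, absNorm (RingHom.ker φ) = p := fun φ ↦ by
    rw [Ideal.absNorm_apply, Submodule.cardQuot_apply]
    refine (Nat.card_congr (RingHom.quotientKerEquivOfSurjective
      (ZMod.ringHom_surjective φ)).toEquiv).trans (Nat.card_zmod p)
  refine Nat.card_congr (Equiv.ofBijective (fun φ ↦ ⟨RingHom.ker φ, hnorm φ⟩) ⟨fun φ ψ h ↦ ?_, ?_⟩)
  · exact ker_injective_of_ringHom_zmod (congrArg Subtype.val h)
  · rintro ⟨I, hI⟩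
    have hcard : Nat.card (𝓞 F ⧸ I) = p := by
      rw [← hI, Ideal.absNorm_apply, Submodule.cardQuot_apply]
    have : Finite (𝓞 F ⧸ I) := Nat.finite_of_card_ne_zero (by rw [hcard]; exact hp.ne_zero)
    let _ := Fintype.ofFinite (𝓞 F ⧸ I)
    let e : ZMod p ≃+* 𝓞 F ⧸ I :=
      ZMod.ringEquivOfPrime _ hp (by rw [← Nat.card_eq_fintype_card, hcard])
    refine ⟨(e.symm : 𝓞 F ⧸ I →+* ZMod p).comp (Ideal.Quotient.mk I), Subtype.ext ?_⟩
    change RingHom.ker _ = I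
    ext x
    simp [RingHom.mem_ker, Ideal.Quotient.eq_zero_iff_mem]

/-- The ring `R` maps to an order of `F` after inverting finitely many primes. -/
structure IsAlmostOrder {R F : Type*} [CommRing R] [Field F] (f : R →+* F) : Prop where
  ker : ∃ M : ℤ, M ≠ 0 ∧ ∀ r, f r = 0 → M * r = 0
  integral : ∃ M : ℤ, M ≠ 0 ∧ ∀ r, ∃ k : ℕ, IsIntegral ℤ ((M : F) ^ k * f r)
  surj : ∀ x : F, ∃ m : ℤ, m ≠ 0 ∧ ∃ r, m * x = f r

/-- An almost order of `F` has as many points modulo `p` as the ring of integers, for almost all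
primes `p`. -/
theorem IsAlmostOrder.exists_forall_card_ringHom_eq {R : Type*} [CommRing R] {f : R →+* F}
    (hf : IsAlmostOrder f) :
    ∃ P : ℕ, ∀ p : ℕ, p.Prime → P < p → Nat.card (R →+* ZMod p) = idealCount F p := by
  classical
  obtain ⟨M₁, hM₁, hker⟩ := hf.ker
  obtain ⟨M₂, hM₂, h_integral⟩ := hf.integral
  choose m hm r hr using hf.surj
  let b := RingOfIntegers.basis F
  set M₃ := ∏ i, m (b i : F)
  have hM₃ : M₃ ≠ 0 := Finset.prod_ne_zero_iff.mpr fun i _ ↦ hm _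
  have hspan : ∀ x : 𝓞 F, ∃ s, (M₃ : F) * x = f s := fun x ↦ by
    refine ⟨∑ i, (b.repr x i : R) *
      ((∏ j ∈ Finset.univ.erase i, m (b j : F) : ℤ) * r (b i : F)), ?_⟩
    have hx : (x : F) = ∑ i, (b.repr x i : F) * (b i : F) := by
      conv_lhs => rw [← b.sum_repr x]
      simp [zsmul_eq_mul]
    rw [hx, map_sum, Finset.mul_sum]
    refine Finset.sum_congr rfl fun i _ ↦ ?_
    rw [map_mul, map_mul, ← hr, map_intCast, map_intCast]
    have : M₃ = m (b i : F) * ∏ j ∈ Finset.univ.erase i, m (b j : F) :=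
      (Finset.mul_prod_erase _ _ (Finset.mem_univ i)).symm
    rw [this]
    push_cast
    ring
  set M := M₁ * M₂ * M₃
  have hM : M ≠ 0 := mul_ne_zero (mul_ne_zero hM₁ hM₂) hM₃
  refine ⟨M.natAbs, fun p hp hlt ↦ ?_⟩
  have := Fact.mk hp
  rw [idealCount_eq_card_ringHom hp]
  refine card_ringHom_eq_card_ringHom f (algebraMap (𝓞 F) F) hM (fun s hs ↦ ⟨1, ?_⟩)
    (fun s hs ↦ ⟨0, ?_⟩) (fun s ↦ ?_) (fun s ↦ ⟨1, ?_⟩) ?_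
  · have := hker s hs
    simp only [M]
    push_cast
    linear_combination (M₂ : R) * M₃ * this
  · rw [pow_zero, one_mul]
    exact (map_eq_zero_iff _ RingOfIntegers.coe_injective).mp hs
  · obtain ⟨k, hk⟩ := h_integral s
    obtain ⟨t, ht⟩ := (IsIntegralClosure.isIntegral_iff (A := 𝓞 F)).mp hk
    refine ⟨k, ((M₁ * M₃ : ℤ) : 𝓞 F) ^ k * t, ?_⟩
    rw [map_mul, map_pow, map_intCast, ht]
    simp only [M]
    push_cast
    ring
  · obtain ⟨t, ht⟩ := hspan s
    refine ⟨((M₁ * M₂ : ℤ) : R) * t, ?_⟩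
    rw [map_mul, ← ht, map_intCast]
    simp only [M]
    push_cast
    ring
  · rw [isUnit_iff_ne_zero, Ne, ZMod.intCast_zmod_eq_zero_iff_dvd]
    intro hdvd
    have := Nat.le_of_dvd (Int.natAbs_pos.mpr hM) (Int.natCast_dvd.mp hdvd)
    omega

end RingOfIntegers

section AdjoinRoot

open Polynomial

theorem isAlmostOrder_adjoinRoot {g : ℤ[X]} [Fact (Irreducible (g.map (Int.castRingHom ℚ)))] :
    IsAlmostOrder (AdjoinRoot.map (Int.castRingHom ℚ) g (g.map (Int.castRingHom ℚ)) dvd_rfl) := by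
  set q := g.map (Int.castRingHom ℚ)
  set f := AdjoinRoot.map (Int.castRingHom ℚ) g q dvd_rfl
  have hq : Irreducible q := Fact.out
  have hg : g ≠ 0 := by
    rintro rfl
    exact hq.ne_zero (Polynomial.map_zero _)
  have hf : ∀ P, f (AdjoinRoot.mk g P) = AdjoinRoot.mk q (P.map (Int.castRingHom ℚ)) := fun P ↦ by
    rw [← AdjoinRoot.aeval_eq, ← AdjoinRoot.aeval_eq, aeval_def, aeval_def, hom_eval₂,
      AdjoinRoot.map_root, eval₂_map]
    exact congrArg (eval₂ · _ P) (RingHom.ext_int _ _)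
  refine ⟨⟨g.content, fun h ↦ hg (content_eq_zero_iff.mp h), fun r hr ↦ ?_⟩,
    ⟨g.leadingCoeff, leadingCoeff_ne_zero.mpr hg, fun r ↦ ?_⟩, fun x ↦ ?_⟩
  · obtain ⟨P, rfl⟩ := AdjoinRoot.mk_surjective r
    rw [hf, AdjoinRoot.mk_eq_zero] at hr
    have h1 : g.primPart ∣ P := by
      rw [IsPrimitive.Int.dvd_iff_map_cast_dvd_map_cast _ _ g.isPrimitive_primPart]
      refine dvd_trans ?_ hr
      exact Polynomial.map_dvd _ g.primPart_dvd
    rw [← map_intCast (AdjoinRoot.mk g), ← map_mul, AdjoinRoot.mk_eq_zero]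
    conv_lhs => rw [g.eq_C_content_mul_primPart]
    exact mul_dvd_mul dvd_rfl h1
  · obtain ⟨P, rfl⟩ := AdjoinRoot.mk_surjective r
    have hroot : IsIntegral ℤ ((g.leadingCoeff : AdjoinRoot q) * AdjoinRoot.root q) := by
      rw [← zsmul_eq_mul]
      refine isIntegral_leadingCoeff_smul g _ ?_
      rw [← aeval_map_algebraMap ℚ]
      exact (AdjoinRoot.aeval_eq q).trans AdjoinRoot.mk_self
    refine ⟨P.natDegree, ?_⟩
    rw [hf, ← AdjoinRoot.aeval_eq, aeval_def, eval₂_map, eval₂_eq_sum_range, Finset.mul_sum]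
    refine IsIntegral.sum _ fun i hi ↦ ?_
    have hi : i ≤ P.natDegree := Nat.lt_succ_iff.mp (Finset.mem_range.mp hi)
    have : (g.leadingCoeff : AdjoinRoot q) ^ P.natDegree *
        (((algebraMap ℚ (AdjoinRoot q)).comp (Int.castRingHom ℚ)) (P.coeff i) *
          AdjoinRoot.root q ^ i) =
        ((g.leadingCoeff ^ (P.natDegree - i) * P.coeff i : ℤ) : AdjoinRoot q) *
          ((g.leadingCoeff : AdjoinRoot q) * AdjoinRoot.root q) ^ i := by
      rw [eq_intCast]
      conv_lhs => rw [← Nat.sub_add_cancel hi]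
      push_cast
      ring
    refine (congrArg (IsIntegral ℤ) this).mpr ?_
    exact (isIntegral_algebraMap (R := ℤ) (x := _)).mul (hroot.pow i)
  · obtain ⟨P, rfl⟩ := AdjoinRoot.mk_surjective x
    obtain ⟨m, hm0, hm⟩ := IsLocalization.integerNormalization_spec (nonZeroDivisors ℤ) P
    refine ⟨m, nonZeroDivisors.ne_zero hm0, AdjoinRoot.mk g (IsLocalization.integerNormalization
      (nonZeroDivisors ℤ) P), ?_⟩
    rw [hf, ← map_intCast (AdjoinRoot.mk q), ← map_mul, ← zsmul_eq_mul]
    exact congrArg _ hm.symm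

theorem AdjoinRoot.exists_eq_add_mul_root {R : Type*} [CommRing R] (a : R)
    (x : AdjoinRoot (X ^ 2 - C a)) :
    ∃ r s, x = AdjoinRoot.of _ r + AdjoinRoot.of _ s * AdjoinRoot.root _ := by
  obtain ⟨P, rfl⟩ := AdjoinRoot.mk_surjective x
  rcases subsingleton_or_nontrivial R with _ | _
  · exact ⟨0, 0, by simp [Subsingleton.elim P 0]⟩
  have hm : (X ^ 2 - C a).Monic := monic_X_pow_sub_C a two_ne_zero
  have hdeg : (P %ₘ (X ^ 2 - C a)).natDegree ≤ 1 := by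
    have := natDegree_modByMonic_lt P hm fun h ↦ by
      have := congrArg natDegree h
      rw [natDegree_X_pow_sub_C, natDegree_one] at this
      omega
    rw [natDegree_X_pow_sub_C] at this
    omega
  obtain ⟨s, r, h⟩ := exists_eq_X_add_C_of_natDegree_le_one hdeg
  refine ⟨r, s, ?_⟩
  have : AdjoinRoot.mk (X ^ 2 - C a) P = AdjoinRoot.mk _ (P %ₘ (X ^ 2 - C a)) := by
    rw [AdjoinRoot.mk_eq_mk]
    exact ⟨P /ₘ (X ^ 2 - C a), by linear_combination - modByMonic_add_div P (X ^ 2 - C a)⟩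
  rw [this, h, map_add, map_mul, AdjoinRoot.mk_C, AdjoinRoot.mk_C, AdjoinRoot.mk_X, add_comm]

theorem AdjoinRoot.eq_zero_of_add_mul_root_eq_zero {R : Type*} [CommRing R] {a r s : R}
    (h : AdjoinRoot.of (X ^ 2 - C a) r + AdjoinRoot.of _ s * AdjoinRoot.root _ = 0) :
    r = 0 ∧ s = 0 := by
  nontriviality R
  have hm : (X ^ 2 - C a).Monic := monic_X_pow_sub_C a two_ne_zero
  have h0 : C s * X + C r = 0 := by
    by_contra hne
    refine AdjoinRoot.mk_ne_zero_of_natDegree_lt hm hne ?_ ?_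
    · rw [natDegree_X_pow_sub_C]
      exact natDegree_linear_le.trans_lt one_lt_two
    · rw [map_add, map_mul, AdjoinRoot.mk_C, AdjoinRoot.mk_C, AdjoinRoot.mk_X, add_comm, h]
  refine ⟨?_, ?_⟩
  · simpa using congrArg (coeff · 0) h0
  · simpa using congrArg (coeff · 1) h0

theorem IsAlmostOrder.adjoinRoot_sqrt {R F : Type*} [CommRing R] [Field F] {f : R →+* F}
    (hf : IsAlmostOrder f) (a : ℤ) [Fact (Irreducible (X ^ 2 - C (a : F)))] :
    IsAlmostOrder (AdjoinRoot.map f (X ^ 2 - C (a : R)) (X ^ 2 - C (a : F))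
      (by simp)) := by
  set f' := AdjoinRoot.map f (X ^ 2 - C (a : R)) (X ^ 2 - C (a : F)) (by simp)
  have hf' : ∀ r s, f' (AdjoinRoot.of _ r + AdjoinRoot.of _ s * AdjoinRoot.root _) =
      AdjoinRoot.of _ (f r) + AdjoinRoot.of _ (f s) * AdjoinRoot.root _ := fun r s ↦ by
    simp [f']
  obtain ⟨M, hM, hker⟩ := hf.ker
  obtain ⟨N, hN, h_integral⟩ := hf.integral
  refine ⟨⟨M, hM, fun x hx ↦ ?_⟩, ⟨N, hN, fun x ↦ ?_⟩, fun x ↦ ?_⟩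
  · obtain ⟨r, s, rfl⟩ := AdjoinRoot.exists_eq_add_mul_root _ x
    rw [hf'] at hx
    obtain ⟨hr, hs⟩ := AdjoinRoot.eq_zero_of_add_mul_root_eq_zero hx
    rw [← map_intCast (AdjoinRoot.of (X ^ 2 - C (a : R)) : R →+* _) M, mul_add, ← mul_assoc,
      ← map_mul, ← map_mul, hker r hr, hker s hs, map_zero, zero_mul, add_zero]
  · obtain ⟨r, s, rfl⟩ := AdjoinRoot.exists_eq_add_mul_root _ x
    obtain ⟨k, hk⟩ := h_integral r
    obtain ⟨l, hl⟩ := h_integral s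
    have hroot : IsIntegral ℤ (AdjoinRoot.root (X ^ 2 - C (a : F))) := by
      refine ⟨X ^ 2 - C a, monic_X_pow_sub_C a two_ne_zero, ?_⟩
      have h := AdjoinRoot.eval₂_root (X ^ 2 - C (a : F))
      rw [eval₂_sub, eval₂_pow, eval₂_X, eval₂_C] at h ⊢
      refine (congrArg (AdjoinRoot.root (X ^ 2 - C (a : F)) ^ 2 - ·) ?_).trans h
      exact (eq_intCast _ a).trans (map_intCast (AdjoinRoot.of (X ^ 2 - C (a : F)) : F →+* _) a).symm
    have hN' : IsIntegral ℤ (N : AdjoinRoot (X ^ 2 - C (a : F))) :=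
      isIntegral_algebraMap (R := ℤ) (x := N)
    have hk' := hk.map (AdjoinRoot.of (X ^ 2 - C (a : F))).toIntAlgHom
    have hl' := hl.map (AdjoinRoot.of (X ^ 2 - C (a : F))).toIntAlgHom
    refine ⟨k + l, ?_⟩
    have := ((hN'.pow l).mul hk').add (((hN'.pow k).mul hl').mul hroot)
    rw [hf']
    have heq : (N : AdjoinRoot (X ^ 2 - C (a : F))) ^ (k + l) *
        (AdjoinRoot.of _ (f r) + AdjoinRoot.of _ (f s) * AdjoinRoot.root _) =
        (N : AdjoinRoot (X ^ 2 - C (a : F))) ^ l * AdjoinRoot.of _ ((N : F) ^ k * f r) +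
          (N : AdjoinRoot (X ^ 2 - C (a : F))) ^ k * AdjoinRoot.of _ ((N : F) ^ l * f s) *
            AdjoinRoot.root _ := by
      rw [map_mul, map_mul, map_pow, map_pow,
        map_intCast (AdjoinRoot.of (X ^ 2 - C (a : F)) : F →+* _) N]
      ring
    exact (congrArg (IsIntegral ℤ) heq).mpr this
  · obtain ⟨u, v, rfl⟩ := AdjoinRoot.exists_eq_add_mul_root _ x
    obtain ⟨m, hm, r, hr⟩ := hf.surj u
    obtain ⟨n, hn, s, hs⟩ := hf.surj v
    refine ⟨m * n, mul_ne_zero hm hn,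
      AdjoinRoot.of _ (n * r) + AdjoinRoot.of _ (m * s) * AdjoinRoot.root _, ?_⟩
    rw [hf', map_mul f, map_mul f, ← hr, ← hs]
    simp only [map_mul, map_intCast]
    push_cast
    ring

/-- The universal property of `AdjoinRoot`. -/
noncomputable def AdjoinRoot.ringHomEquiv {R A : Type*} [CommRing R] [CommRing A] (q : R[X]) :
    (AdjoinRoot q →+* A) ≃ {x : (R →+* A) × A // q.eval₂ x.1 x.2 = 0} where
  toFun φ := ⟨(φ.comp (AdjoinRoot.of q), φ (AdjoinRoot.root q)), by
    rw [← hom_eval₂, AdjoinRoot.eval₂_root, map_zero]⟩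
  invFun x := AdjoinRoot.lift x.1.1 x.1.2 x.2
  left_inv φ := AdjoinRoot.ringHom_ext (AdjoinRoot.lift_comp_of _) (AdjoinRoot.lift_root _)
  right_inv x := Subtype.ext (Prod.ext (AdjoinRoot.lift_comp_of _) (AdjoinRoot.lift_root _))

theorem card_ringHom_adjoinRoot_int (g : ℤ[X]) (p : ℕ) :
    Nat.card (AdjoinRoot g →+* ZMod p) = rhoPoly g p := by
  rw [Nat.card_congr (AdjoinRoot.ringHomEquiv g)]
  refine Nat.card_congr ⟨fun x ↦ ⟨x.1.2, ?_⟩, fun x ↦ ⟨(Int.castRingHom _, x.1), x.2⟩,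
    fun x ↦ Subtype.ext (Prod.ext (RingHom.ext_int _ _) rfl), fun x ↦ rfl⟩
  exact (congrArg (eval₂ · _ g) (RingHom.ext_int _ _)).trans x.2

theorem card_ringHom_adjoinRoot_sqrt {R A : Type*} [CommRing R] [CommRing A] (a : ℤ) :
    Nat.card (AdjoinRoot (X ^ 2 - C (a : R)) →+* A) =
      Nat.card (R →+* A) * Nat.card {y : A // y ^ 2 = a} := by
  rw [Nat.card_congr (AdjoinRoot.ringHomEquiv _), ← Nat.card_prod]
  have h : ∀ x : (R →+* A) × A, (X ^ 2 - C (a : R)).eval₂ x.1 x.2 = 0 ↔ x.2 ^ 2 = a := fun x ↦ by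
    rw [eval₂_sub, eval₂_pow, eval₂_X, eval₂_C, map_intCast, sub_eq_zero]
  exact Nat.card_congr ⟨fun x ↦ ⟨x.1.1, x.1.2, (h _).mp x.2⟩,
    fun x ↦ ⟨(x.1, x.2.1), (h _).mpr x.2.2⟩, fun _ ↦ rfl, fun _ ↦ rfl⟩

theorem card_sq_eq_intCast (a : ℤ) {p : ℕ} (hp : p.Prime) (hp2 : p ≠ 2) :
    (Nat.card {y : ZMod p // y ^ 2 = a} : ℝ) = 1 + chiA a p := by
  have := Fact.mk hp
  have h := legendreSym.card_sqrts p hp2 a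
  have hc : Nat.card {y : ZMod p // y ^ 2 = a} = {x : ZMod p | x ^ 2 = a}.toFinset.card := by
    rw [Nat.card_eq_fintype_card, Set.toFinset_card]
    rfl
  have hχ : chiA a p = legendreSym p a := by
    unfold chiA
    rw [if_neg hp2]
    split_ifs with h0 hsq
    · rw [(legendreSym.eq_zero_iff p a).mpr h0, Int.cast_zero]
    · rw [(legendreSym.eq_one_iff p h0).mpr hsq, Int.cast_one]
    · rw [(legendreSym.eq_neg_one_iff p).mpr hsq, Int.cast_neg, Int.cast_one]
  rw [hχ, hc, ← Int.cast_natCast, h]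
  push_cast
  ring

end AdjoinRoot

section Main

open Polynomial

theorem irreducible_X_sq_sub_C {F : Type*} [Field F] {a : F} (ha : ¬ IsSquare a) :
    Irreducible (X ^ 2 - C a) :=
  (X_pow_sub_C_irreducible_iff_of_prime Nat.prime_two).mpr fun b hb ↦ ha ⟨b, by rw [← hb, sq]⟩

/-- There are number fields `K` and `L` whose primes of degree one over `p` are counted by
`ρ_g(p)` and `ρ_g(p) (1 + χ_a(p))`. -/
theorem exists_numberField_idealCount_eq {g : ℤ[X]} (hirr : Irreducible (g.map (Int.castRingHom ℚ)))
    {a : ℤ} (hnotsq : ¬ IsSquare ((a : AdjoinRoot (g.map (Int.castRingHom ℚ))))) :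
    ∃ (K L : Type) (_ : Field K) (_ : Field L) (_ : NumberField K) (_ : NumberField L) (P : ℕ),
      ∀ p : ℕ, p.Prime → P < p → idealCount K p = rhoPoly g p ∧
        (idealCount L p : ℝ) = rhoPoly g p * (1 + chiA a p) := by
  have := Fact.mk hirr
  set K := AdjoinRoot (g.map (Int.castRingHom ℚ))
  have := Fact.mk (irreducible_X_sq_sub_C hnotsq)
  set L := AdjoinRoot (X ^ 2 - C (a : K))
  have : Module.Finite K L := (monic_X_pow_sub_C (a : K) two_ne_zero).finite_adjoinRoot
  have : NumberField L := NumberField.of_module_finite K L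
  have hK : IsAlmostOrder (F := K) _ := isAlmostOrder_adjoinRoot (g := g)
  obtain ⟨P, hP⟩ := hK.exists_forall_card_ringHom_eq
  obtain ⟨Q, hQ⟩ := (hK.adjoinRoot_sqrt a).exists_forall_card_ringHom_eq
  refine ⟨K, L, inferInstance, inferInstance, inferInstance, inferInstance, max 2 (max P Q),
    fun p hp hlt ↦ ⟨?_, ?_⟩⟩
  · rw [← hP p hp (by omega), card_ringHom_adjoinRoot_int]
  · rw [← hQ p hp (by omega), card_ringHom_adjoinRoot_sqrt, Nat.cast_mul,
      card_sq_eq_intCast a hp (by omega), card_ringHom_adjoinRoot_int]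

end Main

theorem primeCoeff_of_prime {K : Type*} [Field K] [NumberField K] {p : ℕ} (hp : p.Prime) :
    primeCoeff K p = idealCount K p := by
  rw [primeCoeff, if_pos hp]

/-- The primes of degree one of two number fields are equally dense, up to a bounded sum. -/
theorem exists_sum_primeCoeff_sub_div_le (K L : Type*) [Field K] [Field L] [NumberField K]
    [NumberField L] :
    ∃ B : ℝ, ∀ N : ℕ, 2 ≤ N →
      ∑ p ∈ Nat.primesLE N, (primeCoeff L p - primeCoeff K p) / p ≤ B := by
  obtain ⟨C, -, hC⟩ := exists_sum_div_le_tsum_rpow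
  obtain ⟨δ₁, hδ₁, C₁, h₁⟩ := exists_abs_tsum_primeCoeff_add_log_le K
  obtain ⟨δ₂, hδ₂, C₂, h₂⟩ := exists_abs_tsum_primeCoeff_add_log_le L
  set d : ℝ := Module.finrank ℤ (𝓞 L) + Module.finrank ℤ (𝓞 K)
  have hlog2 : 0 < Real.log 2 := Real.log_pos one_lt_two
  set δ := min (min δ₁ δ₂) 1 / 2
  have hδ : 0 < δ := by positivity
  have hlt₁ : δ < δ₁ := by
    have : min (min δ₁ δ₂) 1 ≤ δ₁ := (min_le_left _ _).trans (min_le_left _ _)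
    simp only [δ]; linarith
  have hlt₂ : δ < δ₂ := by
    have : min (min δ₁ δ₂) 1 ≤ δ₂ := (min_le_left _ _).trans (min_le_right _ _)
    simp only [δ]; linarith
  have hlt : δ < 1 := by
    have : min (min δ₁ δ₂) 1 ≤ 1 := min_le_right _ _
    simp only [δ]; linarith
  set η := δ * Real.log 2
  refine ⟨C₁ + C₂ + d * C * (η + 1 / η), fun N hN ↦ ?_⟩
  have hlogN : Real.log 2 ≤ Real.log N := Real.log_le_log two_pos (by exact_mod_cast hN)
  have hlogN0 : 0 < Real.log N := hlog2.trans_le hlogN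
  set ε := η / Real.log N
  have hε : 0 < ε := by positivity
  have hεδ : ε ≤ δ := by
    rw [div_le_iff₀ hlogN0]
    exact mul_le_mul_of_nonneg_left hlogN hδ.le
  have hεN : ε * Real.log N = η := div_mul_cancel₀ _ hlogN0.ne'
  have h := hC (fun n ↦ primeCoeff L n - primeCoeff K n) d
    (fun n hn ↦ by rw [primeCoeff, primeCoeff, if_neg hn, if_neg hn, sub_zero])
    (fun n ↦ abs_le.mpr ⟨by linarith [primeCoeff_nonneg (K := L) n, primeCoeff_le (K := K) n,
        (Nat.cast_nonneg (Module.finrank ℤ (𝓞 L)) : (0 : ℝ) ≤ _)],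
      by linarith [primeCoeff_nonneg (K := K) n, primeCoeff_le (K := L) n,
        (Nat.cast_nonneg (Module.finrank ℤ (𝓞 K)) : (0 : ℝ) ≤ _)]⟩)
    N hN ε hε (by linarith)
  have hsub : ∑' n : ℕ, (primeCoeff L n - primeCoeff K n) * (n : ℝ) ^ (-(1 + ε)) =
      ∑' n : ℕ, primeCoeff L n * (n : ℝ) ^ (-(1 + ε)) -
        ∑' n : ℕ, primeCoeff K n * (n : ℝ) ^ (-(1 + ε)) := by
    rw [← (summable_primeCoeff (by linarith)).tsum_sub (summable_primeCoeff (by linarith))]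
    exact tsum_congr fun n ↦ sub_mul _ _ _
  have hK := abs_le.mp (h₁ (1 + ε) (by linarith) (by linarith))
  have hL := abs_le.mp (h₂ (1 + ε) (by linarith) (by linarith))
  rw [hsub, hεN] at h
  linarith [hK.1, hL.2]

end NumberFields

theorem euler_product_bounded_of_not_isSquare
    (g : Polynomial ℤ) (hirr : Irreducible (g.map (Int.castRingHom ℚ)))
    (hsf : Squarefree (g.map (Int.castRingHom ℚ)))
    (a : ℤ) (ha : ¬ IsSquare a)
    (hnotsq : ¬ IsSquare ((a : AdjoinRoot (g.map (Int.castRingHom ℚ))))) :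
    ∃ P₀ : ℕ, 2 ≤ P₀ ∧ ∃ C : ℝ, 0 < C ∧ ∀ U : ℝ, 2 ≤ U →
      (∏ᶠ p ∈ {p : ℕ | p.Prime ∧ P₀ < p ∧ (p : ℝ) ≤ U},
        (1 + (rhoPoly g p : ℝ) * chiA a p / p)) ≤ C := by
  obtain ⟨K, L, _, _, _, _, P, hP⟩ := exists_numberField_idealCount_eq hirr hnotsq
  obtain ⟨B, hB⟩ := exists_sum_primeCoeff_sub_div_le K L
  set d := Module.finrank ℤ (NumberField.RingOfIntegers K)
  set P₀ := max 2 (max P d)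
  refine ⟨P₀, le_max_left _ _, Real.exp (B + ∑ p ∈ Finset.range (P₀ + 1), (d : ℝ) / p),
    Real.exp_pos _, fun U hU ↦ ?_⟩
  set N := ⌊U⌋₊
  have hN : 2 ≤ N := Nat.le_floor (by exact_mod_cast hU)
  set b : ℕ → ℝ := fun p ↦ primeCoeff L p - primeCoeff K p
  have hb : ∀ p, -(d : ℝ) ≤ b p := fun p ↦ by
    linarith [primeCoeff_nonneg (K := L) p, primeCoeff_le (K := K) p]
  have hset : {p : ℕ | p.Prime ∧ P₀ < p ∧ (p : ℝ) ≤ U} =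
      ((Nat.primesLE N).filter (P₀ < ·) : Finset ℕ) := by
    ext p
    simp only [Set.mem_ofPred_eq, Finset.coe_filter, Nat.mem_primesLE, N,
      Nat.le_floor_iff (by linarith : 0 ≤ U)]
    tauto
  have hterm : ∀ p ∈ (Nat.primesLE N).filter (P₀ < ·),
      1 + (rhoPoly g p : ℝ) * chiA a p / p = 1 + b p / p ∧ 0 ≤ 1 + b p / p := fun p hp ↦ by
    obtain ⟨hp, hlt⟩ := Finset.mem_filter.mp hp
    have hp := (Nat.mem_primesLE.mp hp).2
    obtain ⟨h₁, h₂⟩ := hP p hp (by omega)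
    refine ⟨?_, ?_⟩
    · simp only [b]
      rw [primeCoeff_of_prime hp, primeCoeff_of_prime hp, h₁, h₂]
      ring
    · have hp0 : (0 : ℝ) < p := by exact_mod_cast hp.pos
      have hdp : (d : ℝ) ≤ p := by exact_mod_cast (by omega : d ≤ p)
      have : -1 ≤ b p / p := by
        rw [le_div_iff₀ hp0]
        linarith [hb p]
      linarith
  rw [hset, finprod_mem_coe_finset, Finset.prod_congr rfl fun p hp ↦ (hterm p hp).1]
  calc ∏ p ∈ (Nat.primesLE N).filter (P₀ < ·), (1 + b p / p)
      ≤ ∏ p ∈ (Nat.primesLE N).filter (P₀ < ·), Real.exp (b p / p) :=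
        Finset.prod_le_prod (fun p hp ↦ (hterm p hp).2) fun p _ ↦ by
          linarith [Real.add_one_le_exp (b p / p)]
    _ = Real.exp (∑ p ∈ (Nat.primesLE N).filter (P₀ < ·), b p / p) := (Real.exp_sum _ _).symm
    _ ≤ _ := by
        refine Real.exp_le_exp.mpr ?_
        have hsplit := Finset.sum_filter_add_sum_filter_not (Nat.primesLE N) (P₀ < ·)
          fun p ↦ b p / p
        have hsmall : -∑ p ∈ (Nat.primesLE N).filter (¬ P₀ < ·), b p / p ≤
            ∑ p ∈ Finset.range (P₀ + 1), (d : ℝ) / p := by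
          rw [← Finset.sum_neg_distrib]
          calc _ ≤ ∑ p ∈ (Nat.primesLE N).filter (¬ P₀ < ·), (d : ℝ) / p := by
                refine Finset.sum_le_sum fun p _ ↦ ?_
                rw [← neg_div]
                exact div_le_div_of_nonneg_right (by linarith [hb p]) (Nat.cast_nonneg p)
            _ ≤ _ := by
                refine Finset.sum_le_sum_of_subset_of_nonneg (fun p hp ↦ ?_) fun _ _ _ ↦
                  by positivity
                have := (Finset.mem_filter.mp hp).2
                exact Finset.mem_range.mpr (by omega)
        linarith [hB N hN]
end

section
/- Let g ∈ ℤ[x] be a polynomial that is irreducible over ℚ and has nonzero discriminant, let a be an integer which is not a perfect square, and suppose that a IS a square in the field ℚ[x]/(g). Then there exist constants P₀ ≥ 2 and C > 0 (depending on a and g) such that for all real U ≥ 2, ∏_{P₀ < p ≤ U} (1 + ρ_g(p)·χ_a(p)/p) ≤ C·log U, the product being over primes p in the indicated range. -/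
open Polynomial NumberField

/-- An upper bound of Mertens type for `∑_{p ≤ n} log p / p`. -/
theorem sum_primesLE_log_div_le (n : ℕ) :
    ∑ p ∈ n.primesLE, Real.log p / p ≤ Real.log n + Real.log 4 := by
  rcases n.eq_zero_or_pos with rfl | hn
  · have h : Nat.primesLE 0 = ∅ := by
      ext p
      simp only [Nat.mem_primesLE, Finset.notMem_empty, iff_false]
      rintro ⟨h, hp⟩
      exact hp.pos.ne' (Nat.le_zero.mp h)
    rw [h]
    simpa using Real.log_nonneg (by norm_num : (1 : ℝ) ≤ 4)
  have hdvd : ∏ p ∈ n.primesLE, p ^ (n / p) ∣ n.factorial := by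
    refine Finset.prod_dvd_of_isRelPrime ?_ ?_
    · intro p hp q hq hpq
      simp only [Finset.mem_coe, Nat.mem_primesLE] at hp hq
      exact Nat.coprime_iff_isRelPrime.mp
        (Nat.Coprime.pow _ _ ((Nat.coprime_primes hp.2 hq.2).mpr hpq))
    · intro p hp
      rw [Nat.mem_primesLE] at hp
      rw [hp.2.pow_dvd_factorial_iff (Nat.lt_succ_self _)]
      have h1 : 1 ∈ Finset.Ico 1 (Nat.log p n).succ := by
        simp only [Finset.mem_Ico, le_refl, true_and]
        exact Nat.succ_lt_succ (Nat.log_pos hp.2.one_lt hp.1)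
      simpa using Finset.single_le_sum (f := fun i ↦ n / p ^ i) (fun _ _ ↦ Nat.zero_le _) h1
  have hle : ∏ p ∈ n.primesLE, p ^ (n / p) ≤ n ^ n :=
    (Nat.le_of_dvd n.factorial_pos hdvd).trans n.factorial_le_pow
  have hpos : ∀ p ∈ n.primesLE, (0 : ℝ) < p := fun p hp ↦
    Nat.cast_pos.mpr (Nat.mem_primesLE.mp hp).2.pos
  have hlog : ∑ p ∈ n.primesLE, ((n / p : ℕ) : ℝ) * Real.log p ≤ n * Real.log n := by
    calc ∑ p ∈ n.primesLE, ((n / p : ℕ) : ℝ) * Real.log p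
        = Real.log ((∏ p ∈ n.primesLE, p ^ (n / p) : ℕ) : ℝ) := by
          push_cast
          rw [Real.log_prod fun p hp ↦ (pow_pos (hpos p hp) _).ne']
          simp only [Real.log_pow]
      _ ≤ Real.log ((n ^ n : ℕ) : ℝ) := by
          refine Real.log_le_log ?_ (by exact_mod_cast hle)
          push_cast
          exact Finset.prod_pos fun p hp ↦ pow_pos (hpos p hp) _
      _ = n * Real.log n := by push_cast; rw [Real.log_pow]
  have htheta := Chebyshev.theta_le_log4_mul_x (Nat.cast_nonneg (α := ℝ) n)
  rw [Chebyshev.theta_eq_sum_primesLE_log] at htheta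
  have hn' : (0 : ℝ) < n := by exact_mod_cast hn
  have key : n * ∑ p ∈ n.primesLE, Real.log p / p ≤ n * (Real.log n + Real.log 4) := by
    calc n * ∑ p ∈ n.primesLE, Real.log p / p
        ≤ ∑ p ∈ n.primesLE, (((n / p : ℕ) : ℝ) * Real.log p + Real.log p) := by
          rw [Finset.mul_sum]
          refine Finset.sum_le_sum fun p hp ↦ ?_
          have h := (Nat.lt_floor_add_one ((n : ℝ) / p)).le
          rw [Nat.floor_div_eq_div] at h
          have hl : 0 ≤ Real.log p := Real.log_natCast_nonneg p
          calc n * (Real.log p / p) = n / p * Real.log p := by ring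
            _ ≤ (((n / p : ℕ) : ℝ) + 1) * Real.log p := by gcongr
            _ = _ := by ring
      _ ≤ n * (Real.log n + Real.log 4) := by
          rw [Finset.sum_add_distrib]
          linarith
  exact le_of_mul_le_mul_left key hn'

namespace NumberField

variable {K : Type*} [Field K] [NumberField K]

/-- Finite partial sums of the Dedekind zeta function, taken over ideals. -/
theorem sum_absNorm_rpow_le_norm_dedekindZeta {s : ℝ}
    (hs : LSeriesSummable (fun n ↦ (Nat.card {I : Ideal (𝓞 K) // I.absNorm = n} : ℂ)) s)
    (F : Finset (Ideal (𝓞 K))) (hF : ∀ I ∈ F, I ≠ ⊥) :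
    ∑ I ∈ F, (I.absNorm : ℝ) ^ (-s) ≤ ‖dedekindZeta K s‖ := by
  classical
  set c : ℕ → ℕ := fun n ↦ Nat.card {I : Ideal (𝓞 K) // I.absNorm = n} with hc
  have hterm : ∀ n : ℕ, n ≠ 0 →
      (LSeries.term (fun n ↦ (c n : ℂ)) s n).re = c n * (n : ℝ) ^ (-s) := by
    intro n hn
    rw [LSeries.term_of_ne_zero hn, Real.rpow_neg n.cast_nonneg, ← div_eq_mul_inv,
      ← Complex.ofReal_natCast n, ← Complex.ofReal_cpow n.cast_nonneg, ← Complex.ofReal_natCast,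
      ← Complex.ofReal_div, Complex.ofReal_re]
  have hnn : ∀ n : ℕ, 0 ≤ (LSeries.term (fun n ↦ (c n : ℂ)) s n).re := by
    intro n
    rcases eq_or_ne n 0 with rfl | hn
    · simp
    · rw [hterm n hn]
      positivity
  have hsum : HasSum (fun n ↦ (LSeries.term (fun n ↦ (c n : ℂ)) s n).re)
      (dedekindZeta K s).re := Complex.hasSum_re hs.hasSum
  calc ∑ I ∈ F, (I.absNorm : ℝ) ^ (-s)
      = ∑ n ∈ F.image Ideal.absNorm, ∑ I ∈ F with I.absNorm = n, (I.absNorm : ℝ) ^ (-s) :=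
        (Finset.sum_fiberwise_of_maps_to (fun I hI ↦ Finset.mem_image_of_mem _ hI) _).symm
    _ ≤ ∑ n ∈ F.image Ideal.absNorm, (LSeries.term (fun n ↦ (c n : ℂ)) s n).re := by
        refine Finset.sum_le_sum fun n hn ↦ ?_
        obtain ⟨J, hJ, rfl⟩ := Finset.mem_image.mp hn
        rw [hterm _ (Ideal.absNorm_eq_zero_iff.not.mpr (hF J hJ)),
          Finset.sum_congr rfl (g := fun _ ↦ (J.absNorm : ℝ) ^ (-s))
            (fun I hI ↦ by rw [(Finset.mem_filter.mp hI).2]),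
          Finset.sum_const, nsmul_eq_mul]
        gcongr
        have hfin := Ideal.finite_setOfPred_absNorm_eq (S := 𝓞 K) J.absNorm
        calc (F.filter fun I ↦ I.absNorm = J.absNorm).card
            ≤ hfin.toFinset.card := Finset.card_le_card fun I hI ↦ by
              simpa using (Finset.mem_filter.mp hI).2
          _ = c J.absNorm := (Nat.card_eq_card_finite_toFinset hfin).symm
    _ ≤ (dedekindZeta K s).re := sum_le_hasSum _ (fun n _ ↦ hnn n) hsum
    _ ≤ ‖dedekindZeta K s‖ := Complex.re_le_norm _

/-- Finite Euler products over prime ideals are bounded by partial sums over ideals. -/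
theorem prod_one_add_absNorm_rpow_le_norm_dedekindZeta {s : ℝ}
    (hs : LSeriesSummable (fun n ↦ (Nat.card {I : Ideal (𝓞 K) // I.absNorm = n} : ℂ)) s)
    (T : Finset (Ideal (𝓞 K))) (hT : ∀ P ∈ T, Prime P) :
    ∏ P ∈ T, (1 + (P.absNorm : ℝ) ^ (-s)) ≤ ‖dedekindZeta K s‖ := by
  classical
  have hmem : ∀ S ∈ T.powerset, ∀ P ∈ T, P ∈ S ↔ P ∣ ∏ Q ∈ S, Q := by
    intro S hS P hP
    rw [Finset.mem_powerset] at hS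
    refine ⟨fun h ↦ Finset.dvd_prod_of_mem _ h, fun h ↦ ?_⟩
    obtain ⟨Q, hQ, hPQ⟩ := ((hT P hP).dvd_finsetProd_iff _).mp h
    rwa [associated_iff_eq.mp (((hT P hP).dvd_prime_iff_associated (hT Q (hS hQ))).mp hPQ)]
  have hinj : Set.InjOn (fun S : Finset (Ideal (𝓞 K)) ↦ ∏ Q ∈ S, Q) T.powerset := by
    intro S hS S' hS' h
    ext P
    by_cases hP : P ∈ T
    · rw [hmem S hS P hP, hmem S' hS' P hP]
      exact Eq.to_iff (congrArg (P ∣ ·) h)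
    · exact iff_of_false (fun h ↦ hP (Finset.mem_powerset.mp hS h))
        (fun h ↦ hP (Finset.mem_powerset.mp hS' h))
  rw [Finset.prod_one_add]
  calc ∑ S ∈ T.powerset, ∏ P ∈ S, (P.absNorm : ℝ) ^ (-s)
      = ∑ S ∈ T.powerset, ((∏ P ∈ S, P).absNorm : ℝ) ^ (-s) := by
        refine Finset.sum_congr rfl fun S _ ↦ ?_
        rw [map_prod, Nat.cast_prod, Real.finsetProd_rpow _ _ fun _ _ ↦ Nat.cast_nonneg _]
    _ = ∑ I ∈ T.powerset.image (fun S ↦ ∏ P ∈ S, P), (I.absNorm : ℝ) ^ (-s) :=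
        (Finset.sum_image (f := fun I : Ideal (𝓞 K) ↦ (I.absNorm : ℝ) ^ (-s)) hinj).symm
    _ ≤ ‖dedekindZeta K s‖ := by
        refine sum_absNorm_rpow_le_norm_dedekindZeta hs _ fun I hI ↦ ?_
        obtain ⟨S, hS, rfl⟩ := Finset.mem_image.mp hI
        exact Finset.prod_ne_zero_iff.mpr fun P hP ↦ (hT P (Finset.mem_powerset.mp hS hP)).ne_zero

variable (K) in
/-- Euler products over rational primes, with the number of prime ideals of norm `p` as local
weight, have at most a simple pole at `s = 1`. -/
theorem exists_prod_one_add_card_mul_rpow_le :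
    ∃ δ : ℝ, 0 < δ ∧ ∃ C : ℝ, 0 < C ∧ ∀ s : ℝ, 1 < s → s ≤ 1 + δ →
      ∀ S : Finset ℕ, (∀ p ∈ S, p.Prime) →
        ∏ p ∈ S, (1 + Nat.card {I : Ideal (𝓞 K) // I.absNorm = p} * (p : ℝ) ^ (-s)) ≤
          C / (s - 1) := by
  classical
  have hlim := (tendsto_sub_one_mul_dedekindZeta_nhdsGT K).norm
  set R := ‖(dedekindZeta_residue K : ℂ)‖ with hR
  have hRpos : 0 < R := by simpa [hR] using dedekindZeta_residue_ne_zero K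
  have hev := (hlim.eventually (lt_mem_nhds hRpos)).and
    (hlim.eventually (gt_mem_nhds (lt_add_one R)))
  obtain ⟨u, hu, hsub⟩ := mem_nhdsGT_iff_exists_Ioc_subset.mp hev
  rw [Set.mem_Ioi] at hu
  refine ⟨u - 1, sub_pos.mpr hu, R + 1, by positivity, fun s hs1 hs2 S hS ↦ ?_⟩
  obtain ⟨h0, h1⟩ := hsub ⟨hs1, by linarith⟩
  have hs1' : 0 < s - 1 := sub_pos.mpr hs1
  have hsum : LSeriesSummable (fun n ↦ (Nat.card {I : Ideal (𝓞 K) // I.absNorm = n} : ℂ)) s := by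
    by_contra hns
    have hz : dedekindZeta K s = 0 := tsum_eq_zero_of_not_summable hns
    simp [hz] at h0
  have hzeta : ‖dedekindZeta K s‖ ≤ (R + 1) / (s - 1) := by
    rw [le_div_iff₀' hs1']
    rw [norm_mul, ← Complex.ofReal_one, ← Complex.ofReal_sub, Complex.norm_real,
      Real.norm_of_nonneg hs1'.le] at h1
    exact h1.le
  have hfin : ∀ n : ℕ, {I : Ideal (𝓞 K) | I.absNorm = n}.Finite :=
    fun n ↦ Ideal.finite_setOfPred_absNorm_eq n
  calc ∏ p ∈ S, (1 + Nat.card {I : Ideal (𝓞 K) // I.absNorm = p} * (p : ℝ) ^ (-s))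
      ≤ ∏ p ∈ S, ∏ P ∈ (hfin p).toFinset, (1 + (P.absNorm : ℝ) ^ (-s)) := by
        refine Finset.prod_le_prod (fun p _ ↦ by positivity) fun p _ ↦ ?_
        rw [Finset.prod_congr rfl (g := fun _ ↦ 1 + (p : ℝ) ^ (-s))
            (fun P hP ↦ by rw [(hfin p).mem_toFinset.mp hP]), Finset.prod_const,
          ← Nat.card_eq_card_finite_toFinset (hfin p)]
        have hp : (0 : ℝ) ≤ (p : ℝ) ^ (-s) := by positivity
        exact one_add_mul_le_pow (by linarith) _
    _ = ∏ P ∈ S.biUnion fun p ↦ (hfin p).toFinset, (1 + (P.absNorm : ℝ) ^ (-s)) := by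
        refine (Finset.prod_biUnion fun p _ q _ hpq ↦ ?_).symm
        refine Finset.disjoint_left.mpr fun P hP hP' ↦ hpq ?_
        exact ((hfin p).mem_toFinset.mp hP).symm.trans ((hfin q).mem_toFinset.mp hP')
    _ ≤ ‖dedekindZeta K s‖ := by
        refine prod_one_add_absNorm_rpow_le_norm_dedekindZeta hsum _ fun P hP ↦ ?_
        obtain ⟨p, hp, hP⟩ := Finset.mem_biUnion.mp hP
        have hPp : P.absNorm = p := (hfin p).mem_toFinset.mp hP
        have hirr : Irreducible P.absNorm := hPp ▸ hS p hp
        refine Ideal.prime_of_isPrime ?_ (Ideal.isPrime_of_irreducible_absNorm hirr)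
        rw [Ne, ← Ideal.absNorm_eq_zero_iff]
        exact hirr.ne_zero
    _ ≤ (R + 1) / (s - 1) := hzeta

/-- A generator of a number field has nonzero exponent. -/
theorem exponent_ne_zero_of_adjoin_eq_top {θ : 𝓞 K}
    (hθ : Algebra.adjoin ℚ {(θ : K)} = ⊤) : RingOfIntegers.exponent θ ≠ 0 := by
  have hne : conductor ℤ θ ≠ ⊥ := by
    intro h
    have hmul := conductor_mul_differentIdeal ℤ ℚ K θ hθ
    rw [h, Ideal.bot_mul, eq_comm, Ideal.span_singleton_eq_bot] at hmul
    have hsep : aeval (θ : K) (derivative (minpoly ℚ (θ : K))) ≠ 0 :=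
      (Algebra.IsSeparable.isSeparable ℚ (θ : K)).aeval_derivative_ne_zero (minpoly.aeval _ _)
    apply hsep
    rw [minpoly.isIntegrallyClosed_eq_field_fractions ℚ K θ.isIntegral, derivative_map,
      aeval_map_algebraMap, aeval_algebraMap_apply, hmul, map_zero]
  rw [RingOfIntegers.exponent, Ne, Ideal.absNorm_eq_zero_iff]
  exact fun h ↦ hne (Ideal.eq_bot_of_comap_eq_bot h)

/-- Away from the exponent of `θ`, distinct roots of `minpoly ℤ θ` modulo `p` give distinct prime
ideals of norm `p`. -/
theorem card_roots_minpoly_le_card_absNorm_eq {θ : 𝓞 K} {p : ℕ} [Fact p.Prime]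
    (hp : ¬ p ∣ RingOfIntegers.exponent θ) :
    Nat.card {x : ZMod p // aeval x (minpoly ℤ θ) = 0} ≤
      Nat.card {I : Ideal (𝓞 K) // I.absNorm = p} := by
  have hhom : ∀ x : {x : ZMod p // aeval x (minpoly ℤ θ) = 0},
      ∃ φ : 𝓞 K →+* ZMod p, φ θ = x := by
    rintro ⟨x, hx⟩
    have hx' : ∀ f ∈ Ideal.span {(minpoly ℤ θ).map (Int.castRingHom (ZMod p))},
        evalRingHom x f = 0 := by
      intro f hf
      obtain ⟨q, rfl⟩ := Ideal.mem_span_singleton.mp hf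
      rw [map_mul, coe_evalRingHom, eval_map, show eval₂ (Int.castRingHom (ZMod p)) x
        (minpoly ℤ θ) = 0 from hx, zero_mul]
    refine ⟨(Ideal.Quotient.lift _ (evalRingHom x) hx').comp
      ((RingOfIntegers.ZModXQuotSpanEquivQuotSpan hp).symm.toRingHom.comp
        (Ideal.Quotient.mk (Ideal.span {(p : 𝓞 K)}))), ?_⟩
    have h := RingOfIntegers.ZModXQuotSpanEquivQuotSpan_mk_apply hp X
    rw [aeval_X, ← RingEquiv.eq_symm_apply] at h
    simp [← h]
  choose φ hφ using hhom
  have : Finite {I : Ideal (𝓞 K) // I.absNorm = p} := Ideal.finite_setOfPred_absNorm_eq p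
  refine Nat.card_le_card_of_injective (fun x ↦ ⟨RingHom.ker (φ x), ?_⟩) fun x y hxy ↦ ?_
  · rw [Ideal.absNorm_apply, Submodule.cardQuot_apply, Nat.card_congr
      (RingHom.quotientKerEquivOfSurjective (ZMod.ringHom_surjective (φ x))).toEquiv,
      Nat.card_zmod]
  · obtain ⟨m, hm⟩ := ZMod.intCast_surjective (x : ZMod p)
    have hker : RingHom.ker (φ x) = RingHom.ker (φ y) := congrArg Subtype.val hxy
    have hx : θ - (m : 𝓞 K) ∈ RingHom.ker (φ x) := by
      rw [RingHom.mem_ker, map_sub, hφ, map_intCast, hm, sub_self]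
    rw [hker, RingHom.mem_ker, map_sub, hφ, map_intCast, hm, sub_eq_zero] at hx
    exact Subtype.ext hx.symm

end NumberField

/-- If `β = c α` for roots `α` of an irreducible `g` and `β` of `h`, then multiplication by `c`
sends roots of `g` modulo `p` to roots of `h` modulo `p`, for all primes `p` not dividing some
fixed nonzero integer. -/
theorem exists_forall_aeval_intCast_mul_eq_zero {K : Type*} [Field K] [CharZero K]
    {g h : ℤ[X]} (hirr : Irreducible (g.map (Int.castRingHom ℚ))) {α : K}
    (hα : aeval α g = 0) (c : ℤ) (hh : aeval (c * α : K) h = 0) :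
    ∃ d : ℤ, d ≠ 0 ∧ ∀ p : ℕ, p.Prime → ¬ (p : ℤ) ∣ d → ∀ x : ZMod p, aeval x g = 0 →
      aeval (c * x : ZMod p) h = 0 := by
  have hdvd : g.map (Int.castRingHom ℚ) ∣ (h.comp (C c * X)).map (Int.castRingHom ℚ) := by
    have hgα : aeval α (g.map (Int.castRingHom ℚ)) = 0 := by
      rw [← hα]; exact aeval_map_algebraMap ℚ α g
    have hmin : minpoly ℚ α ∣ (h.comp (C c * X)).map (Int.castRingHom ℚ) := by
      refine minpoly.dvd ℚ α ?_
      rw [← algebraMap_int_eq, aeval_map_algebraMap, aeval_comp]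
      simpa using hh
    rw [← minpoly.eq_of_irreducible hirr hgα] at hmin
    exact (dvd_mul_right _ _).trans hmin
  obtain ⟨q, hq⟩ := hdvd
  obtain ⟨d, hd, hdq⟩ := IsLocalization.integerNormalization_spec (nonZeroDivisors ℤ) q
  set r := IsLocalization.integerNormalization (nonZeroDivisors ℤ) q
  have heq : C d * h.comp (C c * X) = g * r := by
    refine map_injective (Int.castRingHom ℚ) (RingHom.injective_int _) ?_
    rw [algebraMap_int_eq] at hdq
    rw [Polynomial.map_mul, Polynomial.map_mul, hq, hdq, map_C, zsmul_eq_mul]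
    simp only [eq_intCast, map_intCast]
    ring
  refine ⟨d, nonZeroDivisors.ne_zero hd, fun p hp hpd x hx ↦ ?_⟩
  have : Fact p.Prime := ⟨hp⟩
  have hev := congrArg (aeval x) heq
  rw [map_mul, map_mul, hx, zero_mul, aeval_comp] at hev
  have hd' : (d : ZMod p) ≠ 0 := by rwa [Ne, ZMod.intCast_zmod_eq_zero_iff_dvd]
  simpa [hd'] using hev

/-- A polynomial which is nonzero modulo `p` has at most `deg g` roots modulo `p`. -/
theorem rhoPoly_le_natDegree {g : ℤ[X]} {p : ℕ} [Fact p.Prime]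
    (hp : g.map (Int.castRingHom (ZMod p)) ≠ 0) : rhoPoly g p ≤ g.natDegree := by
  classical
  have hset : {x : ZMod p | aeval x g = 0} =
      (g.map (Int.castRingHom (ZMod p))).roots.toFinset := by
    ext x
    simp [hp, IsRoot.def, eval_map, aeval_def]
  calc rhoPoly g p = Set.ncard {x : ZMod p | aeval x g = 0} := rfl
    _ = (g.map (Int.castRingHom (ZMod p))).roots.toFinset.card := by
        rw [hset, Set.ncard_coe_finset]
    _ ≤ (g.map (Int.castRingHom (ZMod p))).roots.card := Multiset.toFinset_card_le _
    _ ≤ g.natDegree := card_roots_map_le_natDegree g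

/-- For almost all primes `p`, the number of roots of `g` modulo `p` is bounded by the degree of `g`
and by the number of prime ideals of norm `p` in the field generated by a root of `g`. -/
theorem exists_forall_rhoPoly_le {K : Type*} [Field K] [NumberField K]
    {g : ℤ[X]} (hirr : Irreducible (g.map (Int.castRingHom ℚ))) {α : K}
    (hα : aeval α g = 0) (hgen : Algebra.adjoin ℚ {α} = ⊤) :
    ∃ P : ℕ, 2 ≤ P ∧ ∀ p : ℕ, p.Prime → P < p → rhoPoly g p ≤ g.natDegree ∧
      rhoPoly g p ≤ Nat.card {I : Ideal (𝓞 K) // I.absNorm = p} := by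
  set c := g.leadingCoeff with hc
  have hc0 : c ≠ 0 := by
    rw [hc, Ne, leadingCoeff_eq_zero]
    rintro rfl
    exact hirr.ne_zero (Polynomial.map_zero _)
  let θ : 𝓞 K := ⟨c • α, isIntegral_leadingCoeff_smul g α hα⟩
  have hθ : (θ : K) = c * α := zsmul_eq_mul α c
  have hθgen : Algebra.adjoin ℚ {(θ : K)} = ⊤ := by
    rw [eq_top_iff, ← hgen, Algebra.adjoin_le_iff, Set.singleton_subset_iff, SetLike.mem_coe]
    have hmem := Subalgebra.smul_mem _ (Algebra.self_mem_adjoin_singleton ℚ (θ : K)) (c : ℚ)⁻¹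
    have hcK : (c : K) ≠ 0 := Int.cast_ne_zero.mpr hc0
    have hα' : (c : ℚ)⁻¹ • (θ : K) = α := by
      rw [hθ, Algebra.smul_def, map_inv₀, map_intCast, inv_mul_cancel_left₀ hcK]
    rwa [hα'] at hmem
  have hmin : aeval (c * α : K) (minpoly ℤ θ) = 0 := by
    rw [← hθ, aeval_algebraMap_apply, minpoly.aeval, map_zero]
  obtain ⟨d, hd0, hd⟩ := exists_forall_aeval_intCast_mul_eq_zero hirr hα c hmin
  have he0 := NumberField.exponent_ne_zero_of_adjoin_eq_top hθgen
  refine ⟨2 + c.natAbs + d.natAbs + RingOfIntegers.exponent θ, by omega, fun p hp hlt ↦ ?_⟩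
  have : Fact p.Prime := ⟨hp⟩
  have hpc : ¬ (p : ℤ) ∣ c := fun h ↦ by
    have := Nat.le_of_dvd (Int.natAbs_pos.mpr hc0) (Int.natCast_dvd.mp h)
    omega
  have hpd : ¬ (p : ℤ) ∣ d := fun h ↦ by
    have := Nat.le_of_dvd (Int.natAbs_pos.mpr hd0) (Int.natCast_dvd.mp h)
    omega
  have hpe : ¬ p ∣ RingOfIntegers.exponent θ := fun h ↦ by
    have := Nat.le_of_dvd (Nat.pos_of_ne_zero he0) h
    omega
  have hc' : (c : ZMod p) ≠ 0 := by rwa [Ne, ZMod.intCast_zmod_eq_zero_iff_dvd]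
  constructor
  · refine rhoPoly_le_natDegree fun h ↦ hc' ?_
    simpa using congrArg (coeff · g.natDegree) h
  · refine le_trans ?_ (NumberField.card_roots_minpoly_le_card_absNorm_eq hpe)
    refine Nat.card_le_card_of_injective
      (fun x ↦ ⟨c * x.1, hd p hp hpd x.1 x.2⟩) fun x y hxy ↦ ?_
    exact Subtype.ext (mul_left_cancel₀ hc' (congrArg Subtype.val hxy))

theorem abs_chiA_le_one (a : ℤ) (p : ℕ) : |chiA a p| ≤ 1 := by
  unfold chiA
  split_ifs <;> simp

/-- Comparison of Euler factors at `1` and at `s = 1 + ε`. -/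
theorem one_add_mul_inv_le_mul_exp {r D x ε : ℝ} (hr : 0 ≤ r) (hrD : r ≤ D) (hx : 1 ≤ x)
    (hε : 0 ≤ ε) :
    1 + r / x ≤ (1 + r * x ^ (-(1 + ε))) * Real.exp (D * ε * (Real.log x / x)) := by
  have hx0 : 0 < x := by linarith
  have hl : 0 ≤ Real.log x := Real.log_nonneg hx
  have hpow : x⁻¹ - x⁻¹ * (ε * Real.log x) ≤ x ^ (-(1 + ε)) := by
    have h := Real.add_one_le_exp (-(ε * Real.log x))
    have hxe : x ^ (-(1 + ε)) = x⁻¹ * Real.exp (-(ε * Real.log x)) := by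
      rw [neg_add, Real.rpow_add hx0, Real.rpow_neg_one, Real.rpow_def_of_pos hx0]
      ring_nf
    have hxi : 0 < x⁻¹ := inv_pos.mpr hx0
    rw [hxe]
    nlinarith
  set A := r * x ^ (-(1 + ε)) with hA
  set B := D * ε * (Real.log x / x) with hB
  have hA0 : 0 ≤ A := by positivity
  have hB0 : 0 ≤ B := mul_nonneg (mul_nonneg (hr.trans hrD) hε) (div_nonneg hl hx0.le)
  have hrB : r * (x⁻¹ * (ε * Real.log x)) ≤ B := by
    calc r * (x⁻¹ * (ε * Real.log x)) ≤ D * (x⁻¹ * (ε * Real.log x)) := by gcongr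
      _ = B := by rw [hB]; ring
  have h1 : r / x ≤ A + B := by
    have := mul_le_mul_of_nonneg_left hpow hr
    rw [div_eq_mul_inv]
    linarith
  calc 1 + r / x ≤ (1 + A) * (B + 1) := by nlinarith
    _ ≤ (1 + A) * Real.exp B := by
        gcongr
        exact Real.add_one_le_exp B

/-- If `a` is a square in `ℚ[x]/(g)` then the Euler products
`∏_{P₀ < p ≤ U} (1 + ρ_g(p) χ_a(p)/p)` grow at most like `log U`. -/
theorem euler_product_log_bound_of_isSquare
    (g : Polynomial ℤ) (hirr : Irreducible (g.map (Int.castRingHom ℚ)))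
    (hsf : Squarefree (g.map (Int.castRingHom ℚ)))
    (a : ℤ) (ha : ¬ IsSquare a)
    (hsq : IsSquare ((a : AdjoinRoot (g.map (Int.castRingHom ℚ))))) :
    ∃ P₀ : ℕ, 2 ≤ P₀ ∧ ∃ C : ℝ, 0 < C ∧ ∀ U : ℝ, 2 ≤ U →
      (∏ᶠ p ∈ {p : ℕ | p.Prime ∧ P₀ < p ∧ (p : ℝ) ≤ U},
        (1 + (rhoPoly g p : ℝ) * chiA a p / p)) ≤ C * Real.log U := by
  have : Fact (Irreducible (g.map (Int.castRingHom ℚ))) := ⟨hirr⟩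
  have hchar : CharZero (AdjoinRoot (g.map (Int.castRingHom ℚ))) :=
    charZero_of_injective_algebraMap (algebraMap ℚ _).injective
  have hfd : FiniteDimensional ℚ (AdjoinRoot (g.map (Int.castRingHom ℚ))) :=
    (AdjoinRoot.powerBasis hirr.ne_zero).finite
  have : NumberField (AdjoinRoot (g.map (Int.castRingHom ℚ))) :=
    { to_charZero := hchar, to_finiteDimensional := hfd }
  have hroot : aeval (AdjoinRoot.root (g.map (Int.castRingHom ℚ))) g = 0 := by
    rw [aeval_def, ← AdjoinRoot.eval₂_root, eval₂_map]
    congr 1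
  obtain ⟨P₀, hP₀, hρ⟩ := exists_forall_rhoPoly_le hirr hroot AdjoinRoot.adjoinRoot_eq_top
  obtain ⟨δ, hδ, C, hC, hbound⟩ :=
    NumberField.exists_prod_one_add_card_mul_rpow_le (AdjoinRoot (g.map (Int.castRingHom ℚ)))
  set D : ℝ := (g.natDegree : ℝ)
  have hlog2 : 0 < Real.log 2 := Real.log_pos one_lt_two
  set κ := δ * Real.log 2 with hκ
  have hκ0 : 0 < κ := mul_pos hδ hlog2
  refine ⟨P₀, hP₀, C / κ * Real.exp (D * κ * 3), by positivity, fun U hU ↦ ?_⟩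
  have hlogU : Real.log 2 ≤ Real.log U := Real.log_le_log two_pos hU
  have hlogU0 : 0 < Real.log U := hlog2.trans_le hlogU
  have hU0 : 0 ≤ U := by linarith
  set S := {p ∈ Nat.primesLE ⌊U⌋₊ | P₀ < p} with hS
  have hmem : ∀ p ∈ S, p.Prime ∧ P₀ < p := fun p hp ↦
    ⟨(Nat.mem_primesLE.mp (Finset.mem_filter.mp hp).1).2, (Finset.mem_filter.mp hp).2⟩
  have hset : {p : ℕ | p.Prime ∧ P₀ < p ∧ (p : ℝ) ≤ U} = S := by
    ext p
    simp only [hS, Set.mem_ofPred_eq, Finset.coe_filter, Nat.mem_primesLE, Nat.le_floor_iff hU0]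
    tauto
  rw [hset, finprod_mem_coe_finset]
  set ε := κ / Real.log U with hε
  have hε0 : 0 < ε := by positivity
  have hεδ : ε ≤ δ := by
    rw [hε, div_le_iff₀ hlogU0]
    exact mul_le_mul_of_nonneg_left hlogU hδ.le
  have hsum : ∑ p ∈ S, Real.log p / p ≤ 3 * Real.log U := by
    calc ∑ p ∈ S, Real.log p / p ≤ ∑ p ∈ Nat.primesLE ⌊U⌋₊, Real.log p / p :=
          Finset.sum_le_sum_of_subset_of_nonneg (Finset.filter_subset _ _)
            fun p _ _ ↦ div_nonneg (Real.log_natCast_nonneg p) p.cast_nonneg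
      _ ≤ Real.log ⌊U⌋₊ + Real.log 4 := sum_primesLE_log_div_le _
      _ ≤ Real.log U + 2 * Real.log 2 := by
          have h4 : Real.log 4 = 2 * Real.log 2 := by
            rw [show (4 : ℝ) = 2 ^ 2 by norm_num, Real.log_pow]
            norm_num
          rw [h4]
          gcongr
          · exact Nat.cast_pos.mpr (Nat.floor_pos.mpr (by linarith))
          · exact Nat.floor_le hU0
      _ ≤ 3 * Real.log U := by linarith
  calc ∏ p ∈ S, (1 + (rhoPoly g p : ℝ) * chiA a p / p)
      ≤ ∏ p ∈ S, |1 + (rhoPoly g p : ℝ) * chiA a p / p| := by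
        rw [← Finset.abs_prod]
        exact le_abs_self _
    _ ≤ ∏ p ∈ S, ((1 + Nat.card {I : Ideal (𝓞 (AdjoinRoot (g.map (Int.castRingHom ℚ)))) //
          I.absNorm = p} * (p : ℝ) ^ (-(1 + ε))) * Real.exp (D * ε * (Real.log p / p))) := by
        refine Finset.prod_le_prod (fun _ _ ↦ abs_nonneg _) fun p hp ↦ ?_
        obtain ⟨hpp, hPp⟩ := hmem p hp
        obtain ⟨hdeg, hcard⟩ := hρ p hpp hPp
        calc |1 + (rhoPoly g p : ℝ) * chiA a p / p|
            ≤ |1| + |(rhoPoly g p : ℝ) * chiA a p / p| := abs_add_le _ _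
          _ = 1 + rhoPoly g p * |chiA a p| / p := by
              rw [abs_one, abs_div, abs_mul, Nat.abs_cast, Nat.abs_cast]
          _ ≤ 1 + rhoPoly g p * 1 / p := by
              gcongr
              exact abs_chiA_le_one a p
          _ = 1 + rhoPoly g p / p := by rw [mul_one]
          _ ≤ (1 + rhoPoly g p * (p : ℝ) ^ (-(1 + ε))) *
                Real.exp (D * ε * (Real.log p / p)) :=
              one_add_mul_inv_le_mul_exp (Nat.cast_nonneg _) (Nat.cast_le.mpr hdeg)
                (Nat.one_le_cast.mpr hpp.one_le) hε0.le
          _ ≤ _ := by gcongr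
    _ = (∏ p ∈ S, (1 + Nat.card {I : Ideal (𝓞 (AdjoinRoot (g.map (Int.castRingHom ℚ)))) //
          I.absNorm = p} * (p : ℝ) ^ (-(1 + ε)))) *
          Real.exp (D * ε * ∑ p ∈ S, Real.log p / p) := by
        rw [Finset.prod_mul_distrib, ← Real.exp_sum, Finset.mul_sum]
    _ ≤ C / (1 + ε - 1) * Real.exp (D * ε * (3 * Real.log U)) := by
        gcongr
        · rw [add_sub_cancel_left]
          positivity
        · exact hbound (1 + ε) (by linarith) (by linarith) S fun p hp ↦ (hmem p hp).1
    _ = C / κ * Real.exp (D * κ * 3) * Real.log U := by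
        have h1 : D * ε * (3 * Real.log U) = D * κ * 3 := by
          rw [hε]
          field_simp
        rw [h1, add_sub_cancel_left, hε]
        field_simp
end
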